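/- Suppose that for some field k and some monomial term order ⪯, the toric ideal I_Λ ⊆ k[z_1,…,z_n] has a Gröbner basis of degree d ≥ 2, i.e. the initial ideal in_⪯(I_Λ) is generated by monomials of total degree at most d. Then for every field K, every λ ∈ Λ, and every integer i with i < −1 + (deg(λ) − 1)/(d − 1), the reduced simplicial homology group H̃_i(Δ(0,λ); K) vanishes. -/

import Mathlib

open scoped Classical

noncomputable section

namespace ASG

variable {e n : ℕ}

/-- Ambient monoid `ℕ^e`. -/
abbrev M (e : ℕ) : Type := Fin e →₀ ℕ

/-- The affine semigroup `Λ` generated by `α 1, …, α n`. -/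
def sg (α : Fin n → M e) : AddSubmonoid (M e) :=
  AddSubmonoid.closure (Set.range α)

/-- The partial order on `Λ` : `μ ≤ ν` iff `ν - μ ∈ Λ`. -/
def sgLE (α : Fin n → M e) (μ ν : M e) : Prop := ∃ δ ∈ sg α, μ + δ = ν

/-- Strict version of the order on `Λ`. -/
def sgLT (α : Fin n → M e) (μ ν : M e) : Prop := sgLE α μ ν ∧ μ ≠ ν

/-- `deg λ` : the least `r` such that `λ` is a sum of `r` generators. -/
def deg (α : Fin n → M e) (l : M e) : ℕ :=
  sInf {r : ℕ | ∃ w : Fin r → Fin n, l = ∑ t, α (w t)}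

/-- Comparability in the poset `Λ`. -/
def cmp2 (α : Fin n → M e) (a b : M e) : Prop := sgLE α a b ∨ sgLE α b a

/-- Faces of the order complex `Δ(x,y)` of the open interval `(x,y)` in `Λ`:
finite chains of elements strictly between `x` and `y`. -/
def IsOFace (α : Fin n → M e) (x y : M e) (S : Finset (M e)) : Prop :=
  (∀ μ ∈ S, μ ∈ sg α ∧ sgLT α x μ ∧ sgLT α μ y) ∧
    (S : Set (M e)).Pairwise (cmp2 α)

/-- Faces with `m` vertices (i.e. of dimension `m - 1`). -/
def OFace (α : Fin n → M e) (x y : M e) (m : ℕ) : Type :=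
  { S : Finset (M e) // IsOFace α x y S ∧ S.card = m }

/-- The simplicial chain group with coefficients in `K` spanned by the faces
with `m` vertices (the augmented/reduced chain complex: for `m = 0` this is a
copy of `K` spanned by the empty face). -/
abbrev OC (K : Type) [Field K] (α : Fin n → M e) (x y : M e) (m : ℕ) : Type :=
  OFace α x y m →₀ K

/-- Deleting a vertex from a face. -/
def erasedOFace {α : Fin n → M e} {x y : M e} {m : ℕ} (S : OFace α x y m)
    (v : M e) (hv : v ∈ S.1) : OFace α x y (m - 1) :=
  ⟨S.1.erase v,
    ⟨fun μ hμ => S.2.1.1 μ (Finset.mem_of_mem_erase hμ),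
      S.2.1.2.mono (Finset.coe_subset.mpr (Finset.erase_subset _ _))⟩,
    by rw [Finset.card_erase_of_mem hv, S.2.2]⟩

/-- The simplicial boundary map of the (augmented) chain complex of `Δ(x,y)`;
the sign of the deletion of a vertex `v` is `(-1)^(number of vertices below v)`. -/
def obd (K : Type) [Field K] (α : Fin n → M e) (x y : M e) (m : ℕ) :
    OC K α x y m →ₗ[K] OC K α x y (m - 1) :=
  Finsupp.linearCombination K fun S : OFace α x y m =>
    ∑ v ∈ S.1.attach,
      ((-1 : K) ^ (S.1.filter fun w => sgLT α w v.1).card) •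
        Finsupp.single (erasedOFace S v.1 v.2) 1

/-- Vanishing of the reduced simplicial homology `H̃_i(Δ(x,y); K)`, for `i : ℤ`:
every reduced `i`-cycle is a boundary.  (An `i`-dimensional face has `i + 1`
vertices; for `i ≤ -2` the statement is vacuous, as is the reduced homology.) -/
def HredVanishes (K : Type) [Field K] (α : Fin n → M e) (x y : M e) (i : ℤ) : Prop :=
  ∀ m : ℕ, (m : ℤ) = i + 1 →
    ∀ c : OC K α x y m, obd K α x y m c = 0 →
      ∃ b : OC K α x y (m + 1), obd K α x y (m + 1) b = c

/-- The reduced simplicial homology group `H̃_(m-1)(Δ(x,y); K)` :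
cycles in the chain group spanned by faces with `m` vertices modulo boundaries,
realized as the image of the cycles in the cokernel of the boundary map. -/
abbrev HredMod (K : Type) [Field K] (α : Fin n → M e) (x y : M e) (m : ℕ) : Type :=
  ↥(Submodule.map (Submodule.mkQ (LinearMap.range (obd K α x y (m + 1))))
      (LinearMap.ker (obd K α x y m)))

end ASG
namespace ASG

variable {e n : ℕ}

/-- The toric ideal `I_Λ = ker φ ⊆ k[z_1, …, z_n]`, where
`φ(z_i) = x^(α i) ∈ k[Λ] ⊆ k[x_1, …, x_e]`. -/
def toricIdeal (k : Type) [Field k] (α : Fin n → M e) : Ideal (MvPolynomial (Fin n) k) :=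
  RingHom.ker (MvPolynomial.aeval (R := k)
    fun i : Fin n => (MvPolynomial.monomial (α i) 1 : MvPolynomial (Fin e) k))

/-- A monomial term order on `k[z_1, …, z_n]` (monomials identified with their
exponent vectors in `ℕ^n`): a linear order such that `1` is least and which is
compatible with multiplication of monomials. -/
def IsTermOrder (ord : LinearOrder (Fin n →₀ ℕ)) : Prop :=
  (∀ a, ord.le 0 a) ∧ ∀ a b c, ord.le a b → ord.le (a + c) (b + c)

/-- The initial ideal `in_⪯(I_Λ)`: the ideal generated by the `⪯`-leading
monomials of the nonzero elements of `I_Λ`. -/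
def initialIdeal (k : Type) [Field k] (ord : LinearOrder (Fin n →₀ ℕ)) (α : Fin n → M e) :
    Ideal (MvPolynomial (Fin n) k) :=
  Ideal.span {p | ∃ f ∈ toricIdeal k α, f ≠ 0 ∧ ∃ mo : Fin n →₀ ℕ,
    (mo ∈ f.support ∧ ∀ m' ∈ f.support, ord.le m' mo) ∧ p = MvPolynomial.monomial mo 1}

/-- `I_Λ` has a Gröbner basis of degree `d` with respect to `⪯` iff `in_⪯(I_Λ)`
is generated by monomials of total degree at most `d`. -/
def HasGB (k : Type) [Field k] (ord : LinearOrder (Fin n →₀ ℕ)) (α : Fin n → M e)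
    (d : ℕ) : Prop :=
  ∃ G : Set (Fin n →₀ ℕ), (∀ mo ∈ G, (mo.sum fun _ c => c) ≤ d) ∧
    Ideal.span ((fun mo => (MvPolynomial.monomial mo 1 : MvPolynomial (Fin n) k)) '' G)
      = initialIdeal k ord α

end ASG
namespace ASGP

section generic
variable {X : Type} {K : Type} [Field K]

/-- Bar differential on words, with a twisted product and a different twist at the head. -/
def D (op : X → X → X) (χ : X → X → K) : (X → X → K) → List X → (List X →₀ K)
  | _, [] => 0
  | _, [_] => 0
  | χ', a :: b :: t =>
      Finsupp.single (op a b :: t) (χ' a b) - Finsupp.lmapDomain K K (List.cons a) (D op χ χ (b :: t))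

def lD (op : X → X → X) (χ χ' : X → X → K) : (List X →₀ K) →ₗ[K] (List X →₀ K) :=
  Finsupp.linearCombination K (D op χ χ')

def hd (op : X → X → X) (χ' : X → X → K) (a : X) : (List X →₀ K) →ₗ[K] (List X →₀ K) :=
  Finsupp.linearCombination K fun w => match w with
    | [] => 0
    | b :: t => Finsupp.single (op a b :: t) (χ' a b)

lemma lD_single (op : X → X → X) (χ χ' : X → X → K) (w : List X) (c : K) :
    lD op χ χ' (Finsupp.single w c) = c • D op χ χ' w := by
  simp [lD]

lemma D_nil (op : X → X → X) (χ χ' : X → X → K) : D op χ χ' [] = 0 := by simp [D]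
lemma D_one (op : X → X → X) (χ χ' : X → X → K) (a : X) : D op χ χ' [a] = 0 := by simp [D]
lemma D_cons (op : X → X → X) (χ χ' : X → X → K) (a b : X) (t : List X) :
    D op χ χ' (a :: b :: t) = Finsupp.single (op a b :: t) (χ' a b)
      - Finsupp.lmapDomain K K (List.cons a) (D op χ χ (b :: t)) := by simp [D]

lemma lD_cons (op : X → X → X) (χ χ' : X → X → K) (a : X) (x : List X →₀ K) :
    lD op χ χ' (Finsupp.lmapDomain K K (List.cons a) x) =
      hd op χ' a x - Finsupp.lmapDomain K K (List.cons a) (lD op χ χ x) := by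
  induction x using Finsupp.induction_linear with
  | zero => simp
  | add f g hf hg => simp only [map_add, hf, hg]; abel
  | single w c =>
    rw [Finsupp.lmapDomain_apply, Finsupp.mapDomain_single, lD_single, lD_single]
    cases w with
    | nil => simp [D_one, D_nil, hd]
    | cons b t =>
      rw [D_cons, smul_sub, map_smul]
      simp [hd]

lemma lD_D (op : X → X → X) (χ : X → X → K) (hop : ∀ a b c, op (op a b) c = op a (op b c))
    (h : ∀ a b c, χ a b * χ (op a b) c = χ b c * χ a (op b c)) (w : List X) :
    ∀ (χ' : X → X → K) (_ : ∀ a b c, χ' a b * χ' (op a b) c = χ b c * χ' a (op b c)),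
    lD op χ χ' (D op χ χ' w) = 0 := by
  induction w with
  | nil => intro χ' _; simp [D_nil]
  | cons a w ih =>
    intro χ' h'
    cases w with
    | nil => simp [D_one]
    | cons b t =>
      rw [D_cons, map_sub, lD_cons, ih χ h, lD_single]
      cases t with
      | nil => simp [D_one]
      | cons c s =>
        rw [D_cons, D_cons, map_sub, map_zero, sub_zero, sub_eq_zero, smul_sub]
        congr 1
        · simp [hd, h', hop]
        · generalize D op χ χ (c :: s) = y
          induction y using Finsupp.induction_linear with
          | zero => simp
          | add f g hf hg => simp only [map_add, smul_add, hf, hg]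
          | single w c => simp [hd, mul_comm]

lemma lD_lD (op : X → X → X) (χ χ' : X → X → K) (hop : ∀ a b c, op (op a b) c = op a (op b c))
    (h : ∀ a b c, χ a b * χ (op a b) c = χ b c * χ a (op b c))
    (h' : ∀ a b c, χ' a b * χ' (op a b) c = χ b c * χ' a (op b c)) (x : List X →₀ K) :
    lD op χ χ' (lD op χ χ' x) = 0 := by
  induction x using Finsupp.induction_linear with
  | zero => simp
  | add f g hf hg => simp only [map_add, hf, hg, add_zero]
  | single w c => rw [lD_single, map_smul, lD_D op χ hop h w χ' h', smul_zero]

lemma mem_D_support {op : X → X → X} {χ χ' : X → X → K} {a b : X} {t w : List X}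
    (hw : w ∈ (D op χ χ' (a :: b :: t)).support) :
    (w = op a b :: t ∧ χ' a b ≠ 0) ∨ ∃ w' ∈ (D op χ χ (b :: t)).support, w = a :: w' := by
  rw [D_cons] at hw
  rcases Finset.mem_union.1 (Finsupp.support_sub hw) with h | h
  · left
    rw [Finsupp.mem_support_iff, Finsupp.single_apply] at h
    split_ifs at h with h1
    · exact ⟨h1.symm, h⟩
    · exact absurd rfl h
  · right
    have := Finsupp.mapDomain_support h
    obtain ⟨w', h1, h2⟩ := Finset.mem_image.1 this
    exact ⟨w', h1, h2.symm⟩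

lemma mem_lD_support {op : X → X → X} {χ χ' : X → X → K} {x : List X →₀ K} {w : List X}
    (hw : w ∈ (lD op χ χ' x).support) : ∃ v ∈ x.support, w ∈ (D op χ χ' v).support := by
  by_contra! hcon
  rw [Finsupp.mem_support_iff] at hw
  apply hw
  rw [lD, Finsupp.linearCombination_apply, Finsupp.sum, Finsupp.finsetSum_apply]
  apply Finset.sum_eq_zero
  intro v hv
  have := hcon v hv
  rw [Finsupp.notMem_support_iff] at this
  simp [this]

lemma D_length {op : X → X → X} {χ : X → X → K} (v : List X) : ∀ {χ' : X → X → K} {w : List X}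
    (_ : w ∈ (D op χ χ' v).support), w.length + 1 = v.length ∧ w ≠ [] := by
  induction v with
  | nil => intro χ' w hw; simp [D_nil] at hw
  | cons a v ih =>
    intro χ' w hw
    cases v with
    | nil => simp [D_one] at hw
    | cons b t =>
      rcases mem_D_support hw with ⟨rfl, _⟩ | ⟨w', h1, rfl⟩
      · simp
      · have := (ih h1).1
        simp at this ⊢; omega

lemma D_all {op : X → X → X} {χ : X → X → K} (R : X → Prop)
    (hR : ∀ a b, R a → R b → χ a b ≠ 0 → R (op a b)) (v : List X) (hv : ∀ a ∈ v, R a) :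
    ∀ {w : List X} (_ : w ∈ (D op χ χ v).support), ∀ a ∈ w, R a := by
  induction v with
  | nil => intro w hw; simp [D_nil] at hw
  | cons a v ih =>
    intro w hw
    cases v with
    | nil => simp [D_one] at hw
    | cons b t =>
      rcases mem_D_support hw with ⟨rfl, h⟩ | ⟨w', h1, rfl⟩
      · intro x hx
        rcases List.mem_cons.1 hx with rfl | hx
        · exact hR _ _ (hv _ (by simp)) (hv _ (by simp)) h
        · exact hv _ (by simp [hx])
      · intro x hx
        rcases List.mem_cons.1 hx with rfl | hx
        · exact hv _ (by simp)
        · exact ih (fun y hy => hv _ (by simp at hy ⊢; tauto)) h1 x hx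

lemma D_sum {A : Type} [AddCommMonoid A] {op : X → X → X} {χ : X → X → K} (g : X → A)
    (hg : ∀ a b, g (op a b) = g a + g b) (v : List X) :
    ∀ {χ' : X → X → K} {w : List X} (_ : w ∈ (D op χ χ' v).support), (w.map g).sum = (v.map g).sum := by
  induction v with
  | nil => intro χ' w hw; simp [D_nil] at hw
  | cons a v ih =>
    intro χ' w hw
    cases v with
    | nil => simp [D_one] at hw
    | cons b t =>
      rcases mem_D_support hw with ⟨rfl, _⟩ | ⟨w', h1, rfl⟩
      · simp [hg, add_assoc]
      · have := (ih h1)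
        simp at this ⊢; rw [this]

end generic
end ASGP
namespace ASGP

section degen
variable {n : ℕ} {K : Type} [Field K]

abbrev MX (n : ℕ) : Type := Fin n →₀ ℕ

lemma lin_congr {X Y : Type} (f g : (X →₀ K) →ₗ[K] (Y →₀ K)) (c : X →₀ K)
    (h : ∀ w ∈ c.support, f (Finsupp.single w 1) = g (Finsupp.single w 1)) : f c = g c := by
  conv_lhs => rw [← Finsupp.sum_single c]
  conv_rhs => rw [← Finsupp.sum_single c]
  rw [Finsupp.sum, map_sum, map_sum]
  apply Finset.sum_congr rfl
  intro w hw
  have : Finsupp.single w (c w) = (c w) • Finsupp.single w (1 : K) := by simp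
  rw [this, map_smul, map_smul, h w hw]

def chi (K : Type) [Field K] (L : Set (MX n)) (a b : MX n) : K := if a + b ∈ L then 0 else 1

def padd (a b : MX n) : MX n := a + b

abbrev DL (K : Type) [Field K] (J L : Set (MX n)) : (List (MX n) →₀ K) →ₗ[K] (List (MX n) →₀ K) :=
  lD padd (chi K J) (chi K L)

def W (J L : Set (MX n)) (r : ℕ) (β : MX n) (w : List (MX n)) : Prop :=
  ∃ a t, w = a :: t ∧ a ∉ L ∧ (∀ b ∈ t, b ∉ J ∧ b ≠ 0) ∧ t.length = r ∧ a + t.sum = β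

def Ex (K : Type) [Field K] (J L : Set (MX n)) (r : ℕ) (β : MX n) : Prop :=
  ∀ c : List (MX n) →₀ K, (∀ w ∈ c.support, W J L r β w) → DL K J L c = 0 →
    ∃ b : List (MX n) →₀ K, (∀ w ∈ b.support, W J L (r + 1) β w) ∧ DL K J L b = c

def Up (L : Set (MX n)) : Prop := ∀ a b, a ∈ L → a + b ∈ L

lemma Up.le {L : Set (MX n)} (h : Up L) {a b : MX n} (ha : a ∈ L) (hab : a ≤ b) : b ∈ L := by
  obtain ⟨c, rfl⟩ := exists_add_of_le hab
  exact h _ _ ha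

lemma padd_assoc (a b c : MX n) : padd (padd a b) c = padd a (padd b c) := by
  simp [padd, add_assoc]

lemma chi_coc {J L : Set (MX n)} (hJ : Up J) (hL : Up L) (hJL : J ⊆ L) (a b c : MX n) :
    chi K L a b * chi K L (padd a b) c = chi K J b c * chi K L a (padd b c) := by
  unfold chi padd
  by_cases h : a + b + c ∈ L
  · simp [h, ← add_assoc]
  · have h1 : a + b ∉ L := fun h' => h (hL _ _ h')
    have h2 : b + c ∉ J := fun h' => h (by
      have := hL _ a (hJL h')
      rwa [add_comm, ← add_assoc] at this)
    simp [h, h1, h2, ← add_assoc]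

lemma W_D {J L : Set (MX n)} {r : ℕ} {β : MX n} {v w : List (MX n)}
    (hv : W J L (r + 1) β v) (hw : w ∈ (D padd (chi K J) (chi K L) v).support) : W J L r β w := by
  obtain ⟨a, t, rfl, ha, ht, hr, hs⟩ := hv
  cases t with
  | nil => simp at hr
  | cons b t =>
    rcases mem_D_support hw with ⟨rfl, h⟩ | ⟨w', h1, rfl⟩
    · refine ⟨_, _, rfl, ?_, fun x hx => ht x (by simp [hx]), by simpa using hr, ?_⟩
      · intro h'; apply h; simp only [chi]; rw [if_pos]; exact h'
      · simpa [padd, add_assoc] using hs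
    · refine ⟨_, _, rfl, ha, ?_, ?_, ?_⟩
      · refine D_all (fun b => b ∉ J ∧ b ≠ 0) ?_ _ ht h1
        intro a b ha hb hab
        refine ⟨fun h' => hab (by simp only [chi]; rw [if_pos]; exact h'), ?_⟩
        intro h0
        simp [padd] at h0
        exact ha.2 h0.1
      · have := (D_length _ h1).1
        omega
      · have := D_sum (fun x => x) (fun a b => rfl) _ h1
        simp at this
        rw [this]; simpa using hs

lemma W_DL {J L : Set (MX n)} {r : ℕ} {β : MX n} {c : List (MX n) →₀ K}
    (hc : ∀ w ∈ c.support, W J L (r + 1) β w) : ∀ w ∈ (DL K J L c).support, W J L r β w := by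
  intro w hw
  obtain ⟨v, h1, h2⟩ := mem_lD_support hw
  exact W_D (hc v h1) h2

lemma ex_zero {J L : Set (MX n)} (hL : Up L) (hJL : J ⊆ L) {β : MX n} (hβ : β ≠ 0) :
    Ex K J L 0 β := by
  intro c hc _
  have hsub : c.support ⊆ {[β]} := by
    intro w hw
    obtain ⟨a, t, rfl, ha, ht, hr, hs⟩ := hc w hw
    have := List.length_eq_zero_iff.1 hr
    subst this
    simp at hs; simp [hs]
  have hcs := Finsupp.support_subset_singleton.1 hsub
  by_cases hβL : β ∈ L
  · refine ⟨0, by simp, ?_⟩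
    rw [map_zero]
    symm
    rw [← Finsupp.support_eq_empty, Finset.eq_empty_iff_forall_notMem]
    intro w hw
    obtain ⟨a, t, h1, ha, ht, hr, hs⟩ := hc w hw
    have := Finset.mem_singleton.1 (hsub hw)
    rw [this] at h1
    simp at h1
    exact ha (h1.1 ▸ hβL)
  · refine ⟨Finsupp.single [0, β] (c [β]), ?_, ?_⟩
    · intro w hw
      have := Finset.mem_singleton.1 (Finsupp.support_single_subset hw)
      subst this
      refine ⟨0, [β], rfl, fun h => hβL ?_, ?_, rfl, by simp⟩
      · simpa using hL _ β h
      · simp; exact ⟨fun h => hβL (hJL h), hβ⟩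
    · conv_rhs => rw [hcs]
      rw [DL, lD_single, D_cons, D_one]
      simp [chi, hβL, padd]

def hot (K : Type) [Field K] : (List (MX n) →₀ K) →ₗ[K] (List (MX n) →₀ K) :=
  Finsupp.linearCombination K fun w => match w with
    | [] => 0
    | a :: t => if a = 0 then 0 else Finsupp.single (0 :: a :: t) 1

lemma hot_cons (a : MX n) (x : List (MX n) →₀ K) :
    hot K (Finsupp.lmapDomain K K (List.cons a) x) = if a = 0 then 0 else
      Finsupp.lmapDomain K K (List.cons 0) (Finsupp.lmapDomain K K (List.cons a) x) := by
  induction x using Finsupp.induction_linear with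
  | zero => simp
  | add f g hf hg => simp only [map_add, hf, hg]; split_ifs <;> simp
  | single w c =>
    simp [hot]

lemma hot_single (a : MX n) (t : List (MX n)) (c : K) :
    hot K (Finsupp.single (a :: t) c) = if a = 0 then 0 else Finsupp.single (0 :: a :: t) c := by
  simp [hot]

lemma ex_base {J : Set (MX n)} (hJ : Up J) (r : ℕ) (β : MX n) : Ex K J J (r + 1) β := by
  intro c hc hcyc
  refine ⟨hot K c, ?_, ?_⟩
  · intro w hw
    have : ∃ v ∈ c.support, ∃ a t, v = a :: t ∧ a ≠ 0 ∧ w = 0 :: a :: t := by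
      by_contra! hcon
      rw [Finsupp.mem_support_iff] at hw
      apply hw
      rw [hot, Finsupp.linearCombination_apply, Finsupp.sum, Finsupp.finsetSum_apply]
      apply Finset.sum_eq_zero
      intro v hv
      cases v with
      | nil => simp
      | cons a t =>
        by_cases ha : a = 0
        · simp [ha]
        · have := hcon _ hv a t rfl ha
          simp [ha, Finsupp.single_apply, Ne.symm this]
    obtain ⟨v, hv, a, t, rfl, ha, rfl⟩ := this
    obtain ⟨a', t', h1, h2, h3, h4, h5⟩ := hc _ hv
    injection h1 with h1 h1'
    subst h1 h1'
    refine ⟨0, _, rfl, ?_, ?_, by simp [h4], by simp [h5]⟩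
    · intro h; apply h2; simpa using hJ _ a h
    · intro b hb
      rcases List.mem_cons.1 hb with rfl | hb
      · exact ⟨h2, ha⟩
      · exact h3 _ hb
  · have : ((DL K J J).comp (hot K) + (hot K).comp (DL K J J)) c = (LinearMap.id : _ →ₗ[K] _) c := by
      apply lin_congr
      intro w hw
      obtain ⟨a, t, rfl, ha, ht, hr, hs⟩ := hc _ hw
      cases t with
      | nil => simp at hr
      | cons b t =>
        have hb := ht b (by simp)
        simp only [LinearMap.add_apply, LinearMap.comp_apply, LinearMap.id_apply]
        rw [hot_single, DL, lD_single, one_smul]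
        by_cases h0 : a = 0
        · subst h0
          rw [if_pos rfl, map_zero, zero_add, D_cons, map_sub, hot_cons, if_pos rfl, sub_zero,
            hot_single, if_neg]
          · simp [chi, hb.1, padd]
          · simp [padd, hb.2]
        · rw [if_neg h0, lD_single, one_smul, D_cons, D_cons, map_sub (hot K), hot_cons, if_neg h0,
            hot_single, if_neg]
          · rw [map_sub]
            simp [chi, ha, padd]
          · simp [padd, h0]
    simpa [hcyc] using this

def shf (m : MX n) : List (MX n) → List (MX n)
  | [] => []
  | a :: t => (a + m) :: t

def unshf (m : MX n) : List (MX n) → List (MX n)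
  | [] => []
  | a :: t => (a - m) :: t

def colon (L : Set (MX n)) (m : MX n) : Set (MX n) := {u | u + m ∈ L}

lemma DL_shf (J L : Set (MX n)) (m : MX n) (x : List (MX n) →₀ K) :
    DL K J L (Finsupp.lmapDomain K K (shf m) x) =
      Finsupp.lmapDomain K K (shf m) (DL K J (colon L m) x) := by
  induction x using Finsupp.induction_linear with
  | zero => simp
  | add f g hf hg => simp only [map_add, hf, hg]
  | single w c =>
    rw [Finsupp.lmapDomain_apply, Finsupp.mapDomain_single, DL, DL, lD_single, lD_single]
    cases w with
    | nil => simp [shf, D_nil]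
    | cons a t =>
      cases t with
      | nil => simp [shf, D_one]
      | cons b t =>
        rw [shf, D_cons, D_cons, map_smul, map_sub]
        congr 2
        · simp [shf, chi, colon, padd, add_right_comm]
        · simp only [Finsupp.lmapDomain_apply]
          rw [← Finsupp.mapDomain_comp]
          rfl

lemma shf_inj (m : MX n) : Function.Injective (shf m) := by
  intro v w h
  cases v <;> cases w <;> simp [shf] at h ⊢
  exact h

def hdN (L : Set (MX n)) (w : List (MX n)) : Prop := ∃ a t, w = a :: t ∧ a ∉ L

def pr (K : Type) [Field K] (L : Set (MX n)) : (List (MX n) →₀ K) →ₗ[K] (List (MX n) →₀ K) where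
  toFun x := x.filter (hdN L)
  map_add' _ _ := Finsupp.filter_add
  map_smul' _ _ := Finsupp.filter_smul

lemma pr_single (L : Set (MX n)) (a : MX n) (t : List (MX n)) (c : K) :
    pr K L (Finsupp.single (a :: t) c) = if a ∈ L then 0 else Finsupp.single (a :: t) c := by
  show Finsupp.filter _ _ = _
  split_ifs with h
  · rw [Finsupp.filter_single_of_neg]
    rintro ⟨a', t', h1, h2⟩
    injection h1 with h1 h1'
    exact h2 (h1 ▸ h)
  · rw [Finsupp.filter_single_of_pos]
    exact ⟨a, t, rfl, h⟩

lemma pr_cons (L : Set (MX n)) (a : MX n) (x : List (MX n) →₀ K) :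
    pr K L (Finsupp.lmapDomain K K (List.cons a) x) = if a ∈ L then 0 else
      Finsupp.lmapDomain K K (List.cons a) x := by
  induction x using Finsupp.induction_linear with
  | zero => simp
  | add f g hf hg => simp only [map_add, hf, hg]; split_ifs <;> simp
  | single w c =>
    rw [Finsupp.lmapDomain_apply, Finsupp.mapDomain_single, pr_single]

lemma DL_pr {J L0 L : Set (MX n)} (hL : Up L) (h0 : L0 ⊆ L) (x : List (MX n) →₀ K) :
    DL K J L (pr K L x) = pr K L (DL K J L0 x) := by
  induction x using Finsupp.induction_linear with
  | zero => simp
  | add f g hf hg => simp only [map_add, hf, hg]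
  | single w c =>
    cases w with
    | nil =>
      have : pr K L (Finsupp.single [] c) = 0 := by
        show Finsupp.filter _ _ = _
        rw [Finsupp.filter_single_of_neg]
        rintro ⟨a, t, h, _⟩
        simp at h
      rw [this, DL, lD_single, D_nil]; simp
    | cons a t =>
      rw [pr_single, DL, DL, lD_single, map_smul]
      cases t with
      | nil => rw [D_one]; split_ifs <;> simp [lD_single, D_one]
      | cons b t =>
        rw [D_cons, map_sub, pr_cons, pr_single]
        by_cases ha : a ∈ L
        · have : padd a b ∈ L := hL _ _ ha
          simp [ha, this]
        · rw [if_neg ha, if_neg ha, lD_single, D_cons]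
          by_cases hb : a + b ∈ L
          · simp [chi, padd, hb]
          · have : a + b ∉ L0 := fun h => hb (h0 h)
            simp [chi, padd, hb, this]

lemma ex_cons {J L0 L : Set (MX n)} (hJ : Up J) (hL0 : Up L0) (hL : Up L) (hJ0 : J ⊆ L0) (m : MX n)
    (hLm : ∀ a, a ∈ L ↔ a ∈ L0 ∨ m ≤ a) {r : ℕ} {β : MX n}
    (hcol : m ≤ β → Ex K J (colon L0 m) r (β - m)) (h0 : Ex K J L0 (r + 1) β) :
    Ex K J L (r + 1) β := by
  intro c hc hcyc
  have hsub : L0 ⊆ L := fun a ha => (hLm a).2 (Or.inl ha)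
  have hprc : ∀ (x : List (MX n) →₀ K), (∀ w ∈ x.support, hdN L w) → pr K L x = x := by
    intro x hx
    show Finsupp.filter _ _ = _
    rw [Finsupp.filter_eq_self_iff]
    intro w hw
    exact hx w (Finsupp.mem_support_iff.2 hw)
  have hc0 : ∀ w ∈ c.support, W J L0 (r + 1) β w := by
    intro w hw
    obtain ⟨a, t, h1, h2, h3⟩ := hc w hw
    exact ⟨a, t, h1, fun h => h2 (hsub h), h3⟩
  have hprcc : pr K L c = c := hprc c (fun w hw => by
    obtain ⟨a, t, h1, h2, h3⟩ := hc w hw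
    exact ⟨a, t, h1, h2⟩)
  have hp0 : pr K L (DL K J L0 c) = 0 := by rw [← DL_pr hL hsub, hprcc, hcyc]
  have hW0 := W_DL hc0
  have hhead : ∀ w ∈ (DL K J L0 c).support, ∃ a t, w = a :: t ∧ m ≤ a ∧ a ∉ L0 := by
    intro w hw
    obtain ⟨a, t, h1, h2, h3⟩ := hW0 w hw
    refine ⟨a, t, h1, ?_, h2⟩
    by_contra hma
    have hp : hdN L w := ⟨a, t, h1, fun h => by rcases (hLm a).1 h with h | h <;> tauto⟩
    have : (pr K L (DL K J L0 c)) w = (DL K J L0 c) w := Finsupp.filter_apply_pos _ _ hp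
    rw [hp0] at this
    exact (Finsupp.mem_support_iff.1 hw) this.symm
  set z := Finsupp.lmapDomain K K (unshf m) (DL K J L0 c) with hz
  have hσz : Finsupp.lmapDomain K K (shf m) z = DL K J L0 c := by
    have : ((Finsupp.lmapDomain K K (shf m)).comp (Finsupp.lmapDomain K K (unshf m))) (DL K J L0 c)
        = (LinearMap.id : _ →ₗ[K] _) (DL K J L0 c) := by
      apply lin_congr
      intro w hw
      obtain ⟨a, t, rfl, h1, h2⟩ := hhead w hw
      simp [shf, unshf, tsub_add_cancel_of_le h1]
    exact this
  have hinj : Function.Injective (Finsupp.lmapDomain K K (shf m)) :=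
    Finsupp.mapDomain_injective (shf_inj m)
  have hzc : DL K J (colon L0 m) z = 0 := by
    apply hinj
    rw [← DL_shf, hσz, map_zero]
    exact lD_lD _ _ _ padd_assoc (chi_coc hJ hJ (le_refl _)) (chi_coc hJ hL0 hJ0) c
  have hzW : ∀ w ∈ z.support, m ≤ β ∧ W J (colon L0 m) r (β - m) w := by
    intro w hw
    obtain ⟨v, hv, rfl⟩ := Finset.mem_image.1 (Finsupp.mapDomain_support hw)
    obtain ⟨a, t, rfl, h1, h2⟩ := hhead v hv
    obtain ⟨a', t', h3, h4, h5, h6, h7⟩ := hW0 _ hv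
    injection h3 with h3 h3'
    subst h3 h3'
    refine ⟨?_, _, _, rfl, ?_, h5, h6, ?_⟩
    · rw [← h7]; exact le_add_right h1
    · simpa [colon, tsub_add_cancel_of_le h1] using h2
    · rw [← h7, tsub_add_eq_add_tsub h1]
  have hy : ∃ y : List (MX n) →₀ K, (∀ w ∈ y.support, m ≤ β ∧ W J (colon L0 m) (r + 1) (β - m) w) ∧
      DL K J (colon L0 m) y = z := by
    by_cases hm : m ≤ β
    · obtain ⟨y, h1, h2⟩ := hcol hm z (fun w hw => (hzW w hw).2) hzc
      exact ⟨y, fun w hw => ⟨hm, h1 w hw⟩, h2⟩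
    · refine ⟨0, by simp, ?_⟩
      rw [map_zero]
      symm
      rw [← Finsupp.support_eq_empty, Finset.eq_empty_iff_forall_notMem]
      intro w hw
      exact hm (hzW w hw).1
  obtain ⟨y, hyW, hy⟩ := hy
  set s := Finsupp.lmapDomain K K (shf m) y with hs
  have hsW : ∀ w ∈ s.support, W J L0 (r + 1) β w ∧ ¬ hdN L w := by
    intro w hw
    obtain ⟨v, hv, rfl⟩ := Finset.mem_image.1 (Finsupp.mapDomain_support hw)
    obtain ⟨hm, a, t, rfl, h1, h2, h3, h4⟩ := hyW v hv
    refine ⟨⟨a + m, t, rfl, h1, h2, h3, ?_⟩, ?_⟩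
    · rw [add_right_comm, h4, tsub_add_cancel_of_le hm]
    · rintro ⟨a', t', h5, h6⟩
      simp [shf] at h5
      apply h6
      rw [hLm, ← h5.1]
      right; exact le_add_self
  have hps : pr K L s = 0 := by
    show Finsupp.filter _ _ = _
    rw [Finsupp.filter_eq_zero_iff]
    intro w hw
    by_contra h
    exact (hsW w (Finsupp.mem_support_iff.2 h)).2 hw
  obtain ⟨e, heW, he⟩ := h0 (c - s) (by
    intro w hw
    rcases Finset.mem_union.1 (Finsupp.support_sub hw) with h | h
    · exact hc0 w h
    · exact (hsW w h).1) (by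
    rw [map_sub, hs, DL_shf, hy, hσz, sub_self])
  refine ⟨pr K L e, ?_, ?_⟩
  · intro w hw
    have h1 : w ∈ (e.filter (hdN L)).support := hw
    rw [Finsupp.support_filter, Finset.mem_filter] at h1
    obtain ⟨a, t, rfl, h2, h3, h4, h5⟩ := heW w h1.1
    obtain ⟨a', t', h6, h7⟩ := h1.2
    injection h6 with h6 h6'
    subst h6 h6'
    exact ⟨_, _, rfl, h7, h3, h4, h5⟩
  · rw [DL_pr hL hsub, he, map_sub, hprcc, hps, sub_zero]

/-- Main exactness step. -/
lemma ex_step {J : Set (MX n)} (hJ : Up J) {d : ℕ} (hd : 1 ≤ d)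
    (hgen : ∀ b ∈ J, ∃ g ∈ J, g ≤ b ∧ g.degree ≤ d + 1) (r : ℕ)
    (ih : ∀ L : Set (MX n), Up L → J ⊆ L → (∀ b ∈ L, b ∈ J ∨ ∃ g ∈ L, g ≤ b ∧ g.degree ≤ d) →
      ∀ β : MX n, r * d < β.degree → Ex K J L r β)
    (t : ℕ) (ht : t ≤ d) (T : Finset (MX n)) (hT : ∀ m ∈ T, m.degree ≤ t) (β : MX n)
    (hβ : t + r * d < β.degree) :
    Ex K J {a | a ∈ J ∨ ∃ m ∈ T, m ≤ a} (r + 1) β := by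
  have hup : ∀ T : Finset (MX n), Up {a | a ∈ J ∨ ∃ m ∈ T, m ≤ a} := by
    intro T a b h
    rcases h with h | ⟨m, hm, h⟩
    · left; exact hJ _ _ h
    · right; exact ⟨m, hm, le_add_right h⟩
  induction T using Finset.induction_on with
  | empty => simpa using ex_base hJ r β
  | insert m T hm ihT =>
    refine ex_cons (L0 := {a | a ∈ J ∨ ∃ m ∈ T, m ≤ a}) hJ (hup T) (hup _) (fun a ha => Or.inl ha) m
      ?_ ?_ (ihT fun x hx => hT x (Finset.mem_insert_of_mem hx))
    · intro a
      simp only [Set.mem_ofPred_eq, Finset.mem_insert]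
      constructor
      · rintro (h | ⟨x, rfl | hx, h⟩)
        · tauto
        · tauto
        · exact Or.inl (Or.inr ⟨x, hx, h⟩)
      · rintro ((h | ⟨x, hx, h⟩) | h)
        · tauto
        · exact Or.inr ⟨x, Or.inr hx, h⟩
        · exact Or.inr ⟨m, Or.inl rfl, h⟩
    · intro hmβ
      have hmt := hT m (Finset.mem_insert_self _ _)
      have hdeg : (β - m).degree + m.degree = β.degree := by
        rw [← map_add, tsub_add_cancel_of_le hmβ]
      apply ih
      · intro a b h
        have := hup T _ b h
        rw [add_right_comm] at this
        exact this
      · intro a ha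
        left; exact hJ _ _ ha
      · intro u hu
        rcases hu with hu | ⟨x, hx, hu⟩
        · obtain ⟨g, hg, hgu, hgd⟩ := hgen _ hu
          by_cases hgu' : g ≤ u
          · left; exact hJ.le hg hgu'
          · right
            refine ⟨g - m, Or.inl (hJ.le hg (le_tsub_add)), tsub_le_iff_right.2 hgu, ?_⟩
            by_contra hlt
            have hle : (g - m) ≤ g := tsub_le_self
            have h1 : (g - (g - m)).degree + (g - m).degree = g.degree := by
              rw [← map_add, tsub_add_cancel_of_le hle]
            have h2 : (g - (g - m)).degree = 0 := by omega
            rw [Finsupp.degree_eq_zero_iff] at h2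
            have h3 : g ≤ g - m := tsub_eq_zero_iff_le.1 h2
            exact hgu' (h3.trans (tsub_le_iff_right.2 hgu))
        · right
          refine ⟨x - m, Or.inr ⟨x, hx, le_tsub_add⟩, tsub_le_iff_right.2 hu, ?_⟩
          have h1 : (x - m).degree ≤ x.degree := Finsupp.degree_mono tsub_le_self
          have := hT x (Finset.mem_insert_of_mem hx)
          omega
      · omega

lemma ex_step' {J : Set (MX n)} (hJ : Up J) {d : ℕ} (hd : 1 ≤ d)
    (hgen : ∀ b ∈ J, ∃ g ∈ J, g ≤ b ∧ g.degree ≤ d + 1) (r : ℕ)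
    (ih : ∀ L : Set (MX n), Up L → J ⊆ L → (∀ b ∈ L, b ∈ J ∨ ∃ g ∈ L, g ≤ b ∧ g.degree ≤ d) →
      ∀ β : MX n, r * d < β.degree → Ex K J L r β)
    (t : ℕ) (ht : t ≤ d) (L : Set (MX n)) (hL : Up L) (hJL : J ⊆ L)
    (hLg : ∀ b ∈ L, b ∈ J ∨ ∃ g ∈ L, g ≤ b ∧ g.degree ≤ t) (β : MX n)
    (hβ : t + r * d < β.degree) : Ex K J L (r + 1) β := by
  have hfin : {g : MX n | g ∈ L ∧ g.degree ≤ t}.Finite := (Finsupp.finite_of_degree_le t).subset fun g h => h.2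
  have := ex_step (K := K) hJ hd hgen r ih t ht hfin.toFinset (by simp) β hβ
  convert this using 1
  ext a
  simp only [Set.Finite.mem_toFinset, Set.mem_ofPred_eq]
  constructor
  · intro ha
    rcases hLg a ha with h | ⟨g, h1, h2, h3⟩
    · exact Or.inl h
    · exact Or.inr ⟨g, ⟨h1, h3⟩, h2⟩
  · rintro (h | ⟨g, ⟨h1, _⟩, h2⟩)
    · exact hJL h
    · exact hL.le h1 h2

lemma ex_all {J : Set (MX n)} (hJ : Up J) {d : ℕ} (hd : 1 ≤ d)
    (hgen : ∀ b ∈ J, ∃ g ∈ J, g ≤ b ∧ g.degree ≤ d + 1) (r : ℕ) :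
    ∀ L : Set (MX n), Up L → J ⊆ L → (∀ b ∈ L, b ∈ J ∨ ∃ g ∈ L, g ≤ b ∧ g.degree ≤ d) →
      ∀ β : MX n, r * d < β.degree → Ex K J L r β := by
  induction r with
  | zero =>
    intro L hL hJL _ β hβ
    refine ex_zero hL hJL ?_
    rintro rfl
    simp at hβ
  | succ r ih =>
    intro L hL hJL hg β hβ
    refine ex_step' hJ hd hgen r ih d le_rfl L hL hJL hg β ?_
    rw [Nat.add_mul] at hβ; omega

/-- Exactness of the bar complex of the monomial ring. -/
lemma ex_bar {J : Set (MX n)} (hJ : Up J) (h0J : 0 ∉ J) {d : ℕ} (hd1 : 1 ≤ d)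
    (hgen : ∀ b ∈ J, ∃ g ∈ J, g ≤ b ∧ g.degree ≤ d + 1) (r : ℕ) (β : MX n)
    (hβ : 1 + r * d < β.degree) (c : List (MX n) →₀ K)
    (hc : ∀ w ∈ c.support, (∀ b ∈ w, b ∉ J ∧ b ≠ 0) ∧ w.length = r + 1 ∧ w.sum = β)
    (hcyc : DL K J J c = 0) :
    ∃ b : List (MX n) →₀ K,
      (∀ w ∈ b.support, (∀ b ∈ w, b ∉ J ∧ b ≠ 0) ∧ w.length = r + 2 ∧ w.sum = β) ∧
      DL K J J b = c := by
  have hL : Up {a : MX n | a ≠ 0} := by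
    intro a b ha h
    simp at h
    exact ha h.1
  have hEx : Ex K J {a : MX n | a ≠ 0} (r + 1) β := by
    refine ex_step' hJ hd1 hgen r (ex_all hJ hd1 hgen r) 1 hd1 _ hL ?_ ?_ β hβ
    · rintro a ha rfl
      exact h0J ha
    · intro b hb
      right
      obtain ⟨i, hi⟩ := Finsupp.ne_iff.1 hb
      refine ⟨Finsupp.single i 1, by simp, ?_, by simp⟩
      rw [Finsupp.single_le_iff]
      simp at hi; omega
  have hhd : ∀ x : List (MX n) →₀ K, (∀ w ∈ x.support, ∀ b ∈ w, b ∉ J ∧ b ≠ 0) →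
      hd padd (chi K {a : MX n | a ≠ 0}) 0 x = 0 := by
    intro x hx
    have : hd padd (chi K {a : MX n | a ≠ 0}) 0 x = (0 : _ →ₗ[K] (List (MX n) →₀ K)) x := by
      apply lin_congr
      intro w hw
      cases w with
      | nil => simp [hd]
      | cons b t =>
        have := (hx _ hw b (by simp)).2
        simp [hd, chi, this]
    simpa using this
  obtain ⟨b, hb, hbc⟩ := hEx (Finsupp.lmapDomain K K (List.cons 0) c) (by
    intro w hw
    obtain ⟨v, hv, rfl⟩ := Finset.mem_image.1 (Finsupp.mapDomain_support hw)
    obtain ⟨h1, h2, h3⟩ := hc v hv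
    exact ⟨0, v, rfl, by simp, h1, h2, by simp [h3]⟩) (by
    rw [DL, lD_cons, hhd c (fun w hw => (hc w hw).1), hcyc]; simp)
  set y := Finsupp.lmapDomain K K List.tail b with hy
  have hyb : Finsupp.lmapDomain K K (List.cons 0) y = b := by
    have : ((Finsupp.lmapDomain K K (List.cons 0)).comp (Finsupp.lmapDomain K K List.tail)) b
        = (LinearMap.id : _ →ₗ[K] _) b := by
      apply lin_congr
      intro w hw
      obtain ⟨a, t, rfl, h1, h2⟩ := hb w hw
      simp at h1
      simp [h1]
    exact this
  have hyW : ∀ w ∈ y.support, (∀ b ∈ w, b ∉ J ∧ b ≠ 0) ∧ w.length = r + 2 ∧ w.sum = β := by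
    intro w hw
    obtain ⟨v, hv, rfl⟩ := Finset.mem_image.1 (Finsupp.mapDomain_support hw)
    obtain ⟨a, t, rfl, h1, h2, h3, h4⟩ := hb v hv
    simp at h1
    exact ⟨h2, h3, by simpa [h1] using h4⟩
  refine ⟨-y, fun w hw => hyW w (by simpa using hw), ?_⟩
  have hinj : Function.Injective (Finsupp.lmapDomain K K (List.cons (0 : MX n))) :=
    Finsupp.mapDomain_injective (List.cons_injective)
  apply hinj
  rw [← hbc, ← hyb, DL, DL, lD_cons, hhd y (fun w hw => (hyW w hw).1), zero_sub, map_neg, map_neg]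

end degen
end ASGP
namespace ASGP
open ASG

section faces
variable {e n : ℕ} {K : Type} [Field K]

def pim (α : Fin n → M e) : MX n →ₗ[ℕ] M e := Finsupp.linearCombination ℕ α

lemma pim_mem (α : Fin n → M e) (a : MX n) : pim α a ∈ sg α := by
  rw [pim, Finsupp.linearCombination_apply]
  rw [Finsupp.sum]
  refine AddSubmonoid.sum_mem _ ?_
  intro i _
  exact AddSubmonoid.nsmul_mem _ (AddSubmonoid.subset_closure (Set.mem_range_self i)) _

lemma mem_sg_iff (α : Fin n → M e) (μ : M e) : μ ∈ sg α ↔ ∃ a, pim α a = μ := by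
  constructor
  · intro h
    have : sg α ≤ AddMonoidHom.mrange (pim α).toAddMonoidHom := by
      rw [sg, AddSubmonoid.closure_le]
      rintro _ ⟨i, rfl⟩
      exact ⟨Finsupp.single i 1, by simp [pim]⟩
    exact this h
  · rintro ⟨a, rfl⟩
    exact pim_mem α a

lemma pim_eq_zero {α : Fin n → M e} (hα : ∀ i, α i ≠ 0) {a : MX n} (h : pim α a = 0) : a = 0 := by
  by_contra ha
  obtain ⟨i, hi⟩ := Finsupp.ne_iff.1 ha
  have hle : Finsupp.single i 1 ≤ a := by
    rw [Finsupp.single_le_iff]; simp at hi; omega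
  obtain ⟨c, rfl⟩ := exists_add_of_le hle
  rw [map_add] at h
  have := (add_eq_zero.1 h).1
  simp [pim] at this
  exact hα i this

lemma sgLT_iff {α : Fin n → M e} (hα : ∀ i, α i ≠ 0) (μ ν : M e) :
    sgLT α μ ν ↔ ∃ a : MX n, a ≠ 0 ∧ ν = μ + pim α a := by
  constructor
  · rintro ⟨⟨δ, hδ, rfl⟩, hne⟩
    obtain ⟨a, rfl⟩ := (mem_sg_iff α δ).1 hδ
    refine ⟨a, ?_, rfl⟩
    rintro rfl
    simp at hne
  · rintro ⟨a, ha, rfl⟩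
    refine ⟨⟨_, pim_mem α a, rfl⟩, ?_⟩
    intro h
    have : pim α a = 0 := by simpa using h
    exact ha (pim_eq_zero hα this)

lemma sgLT_trans {α : Fin n → M e} (hα : ∀ i, α i ≠ 0) {μ ν ξ : M e}
    (h1 : sgLT α μ ν) (h2 : sgLT α ν ξ) : sgLT α μ ξ := by
  rw [sgLT_iff hα] at *
  obtain ⟨a, ha, rfl⟩ := h1
  obtain ⟨b, hb, rfl⟩ := h2
  refine ⟨a + b, ?_, by rw [map_add, add_assoc]⟩
  intro h
  exact ha (add_eq_zero.1 h).1

lemma _root_.ASG.sgLT.lt {α : Fin n → M e} {μ ν : M e} (h : sgLT α μ ν) : μ < ν := by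
  obtain ⟨⟨δ, hδ, rfl⟩, hne⟩ := h
  exact lt_of_le_of_ne le_self_add hne

def F (α : Fin n → M e) : M e → List (MX n) → Finset (M e)
  | _, [] => ∅
  | _, [_] => ∅
  | x, a :: b :: t => insert (x + pim α a) (F α (x + pim α a) (b :: t))

lemma F_cons (α : Fin n → M e) (x : M e) (a : MX n) (w : List (MX n)) (hw : w ≠ []) :
    F α x (a :: w) = insert (x + pim α a) (F α (x + pim α a) w) := by
  cases w with
  | nil => exact absurd rfl hw
  | cons b t => rw [F]

lemma F_mem {α : Fin n → M e} (hα : ∀ i, α i ≠ 0) (w : List (MX n)) : ∀ (x : M e)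
    (_ : ∀ a ∈ w, a ≠ 0), ∀ v ∈ F α x w, sgLT α x v ∧ sgLT α v (x + pim α w.sum) := by
  induction w with
  | nil => intro x _ v hv; simp [F] at hv
  | cons a w ih =>
    intro x hw v hv
    cases w with
    | nil => simp [F] at hv
    | cons b t =>
      rw [F, Finset.mem_insert] at hv
      have hxa : sgLT α x (x + pim α a) := (sgLT_iff hα _ _).2 ⟨a, hw a (by simp), rfl⟩
      rcases hv with rfl | hv
      · refine ⟨hxa, (sgLT_iff hα _ _).2 ⟨b + t.sum, ?_, ?_⟩⟩
        · intro h
          exact hw b (by simp) (add_eq_zero.1 h).1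
        · simp [add_assoc]
      · have := ih (x + pim α a) (fun y hy => hw y (by simp at hy ⊢; tauto)) v hv
        refine ⟨sgLT_trans hα hxa this.1, ?_⟩
        have h2 := this.2
        simpa [add_assoc] using h2

lemma F_notMem {α : Fin n → M e} (hα : ∀ i, α i ≠ 0) (w : List (MX n)) (x : M e)
    (hw : ∀ a ∈ w, a ≠ 0) : x ∉ F α x w := fun h => (F_mem hα w x hw x h).1.2 rfl

lemma F_card {α : Fin n → M e} (hα : ∀ i, α i ≠ 0) (w : List (MX n)) : ∀ (x : M e)
    (_ : ∀ a ∈ w, a ≠ 0), (F α x w).card = w.length - 1 := by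
  induction w with
  | nil => intro x _; simp [F]
  | cons a w ih =>
    intro x hw
    cases w with
    | nil => simp [F]
    | cons b t =>
      have hw' : ∀ y ∈ b :: t, y ≠ 0 := fun y hy => hw y (by simp at hy ⊢; tauto)
      rw [F, Finset.card_insert_of_notMem (F_notMem hα _ _ hw'), ih _ hw']
      simp

lemma F_pairwise {α : Fin n → M e} (hα : ∀ i, α i ≠ 0) (w : List (MX n)) : ∀ (x : M e)
    (_ : ∀ a ∈ w, a ≠ 0), (F α x w : Set (M e)).Pairwise (cmp2 α) := by
  induction w with
  | nil => intro x _; simp [F]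
  | cons a w ih =>
    intro x hw
    cases w with
    | nil => simp [F]
    | cons b t =>
      have hw' : ∀ y ∈ b :: t, y ≠ 0 := fun y hy => hw y (by simp at hy ⊢; tauto)
      rw [F, Finset.coe_insert]
      refine (ih _ hw').insert ?_
      intro v hv _
      have := (F_mem hα _ _ hw' v hv).1.1
      exact ⟨Or.inl this, Or.inr this⟩

lemma F_face {α : Fin n → M e} (hα : ∀ i, α i ≠ 0) (w : List (MX n)) (hw : ∀ a ∈ w, a ≠ 0) :
    IsOFace α 0 (pim α w.sum) (F α 0 w) := by
  refine ⟨?_, F_pairwise hα w 0 hw⟩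
  intro v hv
  have := F_mem hα w 0 hw v hv
  rw [zero_add] at this
  refine ⟨?_, this⟩
  obtain ⟨⟨δ, hδ, h⟩, _⟩ := this.1
  rw [zero_add] at h
  exact h ▸ hδ

/-- simplicial boundary on all finsets -/
def bd (K : Type) [Field K] (α : Fin n → M e) : (Finset (M e) →₀ K) →ₗ[K] (Finset (M e) →₀ K) :=
  Finsupp.linearCombination K fun S => ∑ v ∈ S,
    ((-1 : K) ^ (S.filter fun w => sgLT α w v).card) • Finsupp.single (S.erase v) 1

lemma bd_insert {α : Fin n → M e} (u : M e) (S : Finset (M e)) (hS : ∀ s ∈ S, sgLT α u s) :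
    bd K α (Finsupp.single (insert u S) 1) = Finsupp.single S 1 -
      Finsupp.lmapDomain K K (insert u) (bd K α (Finsupp.single S 1)) := by
  have hu : u ∉ S := fun h => (hS u h).2 rfl
  simp only [bd, Finsupp.linearCombination_single, one_smul]
  rw [Finset.sum_insert hu, map_sum, sub_eq_add_neg, ← Finset.sum_neg_distrib]
  congr 1
  · rw [Finset.erase_insert hu, Finset.filter_false_of_mem]
    · simp
    · intro w hw h
      rcases Finset.mem_insert.1 hw with rfl | hw
      · exact h.2 rfl
      · exact absurd (hS w hw).lt (lt_asymm h.lt)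
  · apply Finset.sum_congr rfl
    intro v hv
    have huv : u ≠ v := fun h => hu (h ▸ hv)
    rw [Finset.filter_insert, if_pos (hS v hv), Finset.card_insert_of_notMem, pow_succ,
      Finset.erase_insert_of_ne huv]
    · simp
    · simp [hu]

lemma F_D {α : Fin n → M e} (hα : ∀ i, α i ≠ 0) (op : MX n → MX n → MX n)
    (hop : ∀ a b, pim α (op a b) = pim α a + pim α b) (w : List (MX n)) :
    ∀ (x : M e) (_ : ∀ a ∈ w, a ≠ 0),
    Finsupp.lmapDomain K K (F α x) (D op (fun _ _ => 1) (fun _ _ => 1) w) =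
      bd K α (Finsupp.single (F α x w) 1) := by
  induction w with
  | nil => intro x _; simp [F, D_nil, bd]
  | cons a w ih =>
    intro x hw
    cases w with
    | nil => simp [F, D_one, bd]
    | cons b t =>
      have hw' : ∀ y ∈ b :: t, y ≠ 0 := fun y hy => hw y (by simp at hy ⊢; tauto)
      rw [F, bd_insert _ _ (fun s hs => (F_mem hα _ _ hw' s hs).1), ← ih _ hw', D_cons, map_sub]
      congr 1
      · rw [Finsupp.lmapDomain_apply, Finsupp.mapDomain_single]
        congr 1
        cases t with
        | nil => simp [F]
        | cons c s => rw [F, F, hop, add_assoc]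
      · have : ((Finsupp.lmapDomain K K (F α x)).comp (Finsupp.lmapDomain K K (List.cons a)))
          (D op (fun _ _ => 1) (fun _ _ => 1) (b :: t)) =
          ((Finsupp.lmapDomain K K (insert (x + pim α a))).comp
            (Finsupp.lmapDomain K K (F α (x + pim α a))))
          (D op (fun _ _ => 1) (fun _ _ => 1) (b :: t)) := by
          apply lin_congr
          intro w hw
          simp [F_cons α x a w (D_length _ hw).2]
        exact this

lemma F_lD {α : Fin n → M e} (hα : ∀ i, α i ≠ 0) (op : MX n → MX n → MX n)
    (hop : ∀ a b, pim α (op a b) = pim α a + pim α b) (C : List (MX n) →₀ K)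
    (hC : ∀ w ∈ C.support, ∀ a ∈ w, a ≠ 0) :
    Finsupp.lmapDomain K K (F α 0) (lD op (fun _ _ => 1) (fun _ _ => 1) C) =
      bd K α (Finsupp.lmapDomain K K (F α 0) C) := by
  have := lin_congr ((Finsupp.lmapDomain K K (F α 0)).comp (lD op (fun _ _ => 1) (fun _ _ => 1)))
    ((bd K α).comp (Finsupp.lmapDomain K K (F α 0))) C (by
      intro w hw
      simp only [LinearMap.comp_apply]
      rw [lD_single, one_smul, F_D hα op hop w 0 (hC w hw), Finsupp.lmapDomain_apply,
        Finsupp.mapDomain_single])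
  exact this

lemma F_inj {α : Fin n → M e} (hα : ∀ i, α i ≠ 0) (P : MX n → Prop)
    (hP : ∀ a b, P a → P b → pim α a = pim α b → a = b) (hP0 : ∀ a, P a → a ≠ 0)
    (w : List (MX n)) : ∀ (w' : List (MX n)) (x : M e)
    (_ : ∀ a ∈ w, P a) (_ : ∀ a ∈ w', P a) (_ : w ≠ []) (_ : w' ≠ [])
    (_ : pim α w.sum = pim α w'.sum) (_ : F α x w = F α x w'), w = w' := by
  induction w with
  | nil => intro w' x _ _ h; exact absurd rfl h
  | cons a w ih =>
    intro w' x hw hw' _ hne' hs hF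
    have hc := F_card hα (a :: w) x (fun y hy => hP0 y (hw y hy))
    have hc' := F_card hα w' x (fun y hy => hP0 y (hw' y hy))
    rw [hF, hc'] at hc
    cases w' with
    | nil => exact absurd rfl hne'
    | cons a' w' =>
      simp at hc
      cases w with
      | nil =>
        have : w' = [] := List.length_eq_zero_iff.1 (by simpa using hc)
        subst this
        have := hP a a' (hw a (by simp)) (hw' a' (by simp)) (by simpa using hs)
        rw [this]
      | cons b t =>
        cases w' with
        | nil => simp at hc
        | cons b' t' =>
          have h1 : ∀ y ∈ b :: t, P y := fun y hy => hw y (by simp at hy ⊢; tauto)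
          have h1' : ∀ y ∈ b' :: t', P y := fun y hy => hw' y (by simp at hy ⊢; tauto)
          have h2 := fun s hs => (F_mem hα (b :: t) (x + pim α a) (fun y hy => hP0 y (h1 y hy)) s hs).1
          have h2' := fun s hs =>
            (F_mem hα (b' :: t') (x + pim α a') (fun y hy => hP0 y (h1' y hy)) s hs).1
          have h3 := F_notMem hα (b :: t) (x + pim α a) (fun y hy => hP0 y (h1 y hy))
          have h3' := F_notMem hα (b' :: t') (x + pim α a') (fun y hy => hP0 y (h1' y hy))
          rw [F, F] at hF
          have haa : x + pim α a = x + pim α a' := by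
            by_contra hne
            have m1 : x + pim α a ∈ F α (x + pim α a') (b' :: t') := by
              have := hF ▸ Finset.mem_insert_self (x + pim α a) (F α (x + pim α a) (b :: t))
              exact (Finset.mem_insert.1 this).resolve_left hne
            have m2 : x + pim α a' ∈ F α (x + pim α a) (b :: t) := by
              have := hF.symm ▸ Finset.mem_insert_self (x + pim α a') (F α (x + pim α a') (b' :: t'))
              exact (Finset.mem_insert.1 this).resolve_left (Ne.symm hne)
            exact absurd (h2 _ m2).lt (lt_asymm (h2' _ m1).lt)
          have hpa : pim α a = pim α a' := by simpa using haa
          have ha : a = a' := hP a a' (hw a (by simp)) (hw' a' (by simp)) hpa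
          subst ha
          have hF' : F α (x + pim α a) (b :: t) = F α (x + pim α a) (b' :: t') := by
            rw [← Finset.erase_insert h3, hF, Finset.erase_insert h3']
          rw [ih (b' :: t') _ h1 h1' (by simp) (by simp) (by simpa using hs) hF']

lemma F_surj {α : Fin n → M e} (hα : ∀ i, α i ≠ 0) (nf : MX n → MX n)
    (hnf : ∀ a, pim α (nf a) = pim α a) (N : ℕ) : ∀ (S : Finset (M e)) (x y : M e) (_ : S.card = N)
    (_ : sgLT α x y) (_ : ∀ v ∈ S, sgLT α x v ∧ sgLT α v y)
    (_ : (S : Set (M e)).Pairwise (cmp2 α)),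
    ∃ w : List (MX n), (∀ a ∈ w, a ≠ 0 ∧ a ∈ Set.range nf) ∧ x + pim α w.sum = y ∧
      F α x w = S ∧ w.length = N + 1 := by
  have hstep : ∀ x y, sgLT α x y → ∃ a, a ≠ 0 ∧ a ∈ Set.range nf ∧ x + pim α a = y := by
    intro x y h
    obtain ⟨a, ha, rfl⟩ := (sgLT_iff hα _ _).1 h
    refine ⟨nf a, ?_, ⟨a, rfl⟩, by rw [hnf]⟩
    intro h0
    apply ha
    apply pim_eq_zero hα
    rw [← hnf, h0, map_zero]
  induction N with
  | zero =>
    intro S x y hS hxy _ _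
    obtain ⟨a, h1, h2, h3⟩ := hstep x y hxy
    refine ⟨[a], by simp [h1]; simpa using h2, by simpa using h3, ?_, rfl⟩
    rw [Finset.card_eq_zero.1 hS]; simp [F]
  | succ N ih =>
    intro S x y hS hxy hmem hpw
    have hne : S.Nonempty := Finset.card_pos.1 (by omega)
    obtain ⟨v, hvS, hv⟩ := S.exists_minimal hne
    have hlt : ∀ u ∈ S.erase v, sgLT α v u := by
      intro u hu
      obtain ⟨huv, huS⟩ := Finset.mem_erase.1 hu
      rcases hpw hvS huS (Ne.symm huv) with h | h
      · exact ⟨h, Ne.symm huv⟩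
      · have h1 : sgLT α u v := ⟨h, huv⟩
        exact absurd (hv huS (ASG.sgLT.lt h1).le) ((ASG.sgLT.lt h1).not_ge)
    obtain ⟨a, h1, h2, h3⟩ := hstep x v (hmem v hvS).1
    obtain ⟨w, g1, g2, g3, g4⟩ := ih (S.erase v) v y (by rw [Finset.card_erase_of_mem hvS]; omega)
      (hmem v hvS).2 (fun u hu => ⟨hlt u hu, (hmem u (Finset.mem_of_mem_erase hu)).2⟩)
      (hpw.mono (Finset.coe_subset.mpr (Finset.erase_subset _ _)))
    refine ⟨a :: w, ?_, ?_, ?_, by simp [g4]⟩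
    · intro b hb
      rcases List.mem_cons.1 hb with rfl | hb
      · exact ⟨h1, h2⟩
      · exact g1 b hb
    · rw [List.sum_cons, map_add, ← add_assoc, h3, g2]
    · rw [F_cons α x a w (by rintro rfl; simp at g4), h3, g3, Finset.insert_erase hvS]

def oval {α : Fin n → M e} {x y : M e} {m : ℕ} (S : OFace α x y m) : Finset (M e) := S.1

lemma oval_inj {α : Fin n → M e} {x y : M e} {m : ℕ} :
    Function.Injective (oval : OFace α x y m → Finset (M e)) := fun _ _ h => Subtype.ext h

def emb (K : Type) [Field K] (α : Fin n → M e) (x y : M e) (m : ℕ) :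
    OC K α x y m →ₗ[K] (Finset (M e) →₀ K) := Finsupp.lmapDomain K K oval

lemma emb_inj (α : Fin n → M e) (x y : M e) (m : ℕ) : Function.Injective (emb K α x y m) :=
  Finsupp.mapDomain_injective oval_inj

lemma emb_obd (α : Fin n → M e) (x y : M e) (m : ℕ) (c : OC K α x y m) :
    emb K α x y (m - 1) (obd K α x y m c) = bd K α (emb K α x y m c) := by
  have := lin_congr ((emb K α x y (m - 1)).comp (obd K α x y m)) ((bd K α).comp (emb K α x y m)) c (by
    intro S _
    simp only [LinearMap.comp_apply, obd, bd, emb, Finsupp.lmapDomain_apply,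
      Finsupp.mapDomain_single, Finsupp.linearCombination_single, one_smul]
    rw [← Finsupp.lmapDomain_apply K K, map_sum]
    simp only [oval]
    conv_rhs => rw [← Finset.sum_attach]
    apply Finset.sum_congr rfl
    intro v _
    rw [map_smul, Finsupp.lmapDomain_apply, Finsupp.mapDomain_single]
    rfl)
  exact this

/-- Transfer from words to faces. -/
lemma transfer {α : Fin n → M e} (hα : ∀ i, α i ≠ 0) (nf : MX n → MX n)
    (hnf : ∀ a, pim α (nf a) = pim α a) (hnf' : ∀ a b, pim α a = pim α b → nf a = nf b)
    (lam : M e) (hlam : sgLT α 0 lam) (m : ℕ)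
    (hex : ∀ C : List (MX n) →₀ K,
      (∀ w ∈ C.support, (∀ a ∈ w, nf a = a ∧ a ≠ 0) ∧ w.length = m + 1 ∧ pim α w.sum = lam) →
      lD (fun a b => nf (a + b)) (fun _ _ => 1) (fun _ _ => 1) C = 0 →
      ∃ B : List (MX n) →₀ K,
      (∀ w ∈ B.support, (∀ a ∈ w, nf a = a ∧ a ≠ 0) ∧ w.length = m + 2 ∧ pim α w.sum = lam) ∧
      lD (fun a b => nf (a + b)) (fun _ _ => 1) (fun _ _ => 1) B = C)
    (c : OC K α 0 lam m) (hc : obd K α 0 lam m c = 0) :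
    ∃ b : OC K α 0 lam (m + 1), obd K α 0 lam (m + 1) b = c := by
  have hidem : ∀ a, nf (nf a) = nf a := fun a => hnf' _ _ (hnf a)
  have hop : ∀ a b, pim α (nf (a + b)) = pim α a + pim α b := fun a b => by rw [hnf, map_add]
  have hsur : ∀ S : OFace α 0 lam m, ∃ w : List (MX n), ((∀ a ∈ w, nf a = a ∧ a ≠ 0) ∧
      w.length = m + 1 ∧ pim α w.sum = lam) ∧ F α 0 w = S.1 := by
    intro S
    obtain ⟨w, h1, h2, h3, h4⟩ := F_surj hα nf hnf m S.1 0 lam S.2.2 hlam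
      (fun v hv => (S.2.1.1 v hv).2) S.2.1.2
    refine ⟨w, ⟨?_, h4, by simpa using h2⟩, h3⟩
    intro a ha
    obtain ⟨h5, b, rfl⟩ := h1 a ha
    exact ⟨hidem b, h5⟩
  choose wd hwd hFwd using hsur
  set C := Finsupp.lmapDomain K K wd c with hCdef
  have hCW : ∀ w ∈ C.support, (∀ a ∈ w, nf a = a ∧ a ≠ 0) ∧ w.length = m + 1 ∧
      pim α w.sum = lam := by
    intro w hw
    obtain ⟨v, hv, rfl⟩ := Finset.mem_image.1 (Finsupp.mapDomain_support hw)
    exact hwd v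
  have hFC : Finsupp.lmapDomain K K (F α 0) C = emb K α 0 lam m c := by
    rw [hCdef, Finsupp.lmapDomain_apply, Finsupp.lmapDomain_apply, ← Finsupp.mapDomain_comp, emb,
      Finsupp.lmapDomain_apply]
    congr 1
    funext S
    exact hFwd S
  have hDC : lD (fun a b => nf (a + b)) (fun _ _ => 1) (fun _ _ => 1) C = 0 := by
    have hz : Finsupp.lmapDomain K K (F α 0)
        (lD (fun a b => nf (a + b)) (fun _ _ => 1) (fun _ _ => 1) C) = 0 := by
      rw [F_lD hα _ hop C (fun w hw a ha => ((hCW w hw).1 a ha).2), hFC, ← emb_obd, hc, map_zero]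
    have hinj : Set.InjOn (F α 0) {w | (∀ a ∈ w, nf a = a ∧ a ≠ 0) ∧ w ≠ [] ∧
        pim α w.sum = lam} := by
      rintro w ⟨h1, h2, h3⟩ w' ⟨h1', h2', h3'⟩ h
      refine F_inj hα (fun a => nf a = a ∧ a ≠ 0) ?_ (fun a h => h.2) w w' 0 h1 h1' h2 h2'
        (h3.trans h3'.symm) h
      intro a b ha hb hab
      rw [← ha.1, ← hb.1, hnf' _ _ hab]
    refine Finsupp.mapDomain_injOn _ hinj ?_ (by simp) (by simpa using hz)
    intro w hw
    obtain ⟨v, hv, hwv⟩ := mem_lD_support (Finset.mem_coe.1 hw)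
    obtain ⟨h1, h2, h3⟩ := hCW v hv
    refine ⟨?_, (D_length _ hwv).2, ?_⟩
    · refine D_all (fun a => nf a = a ∧ a ≠ 0) ?_ v h1 hwv
      intro a b ha hb _
      refine ⟨hidem _, ?_⟩
      intro h0
      have := hop a b
      rw [h0, map_zero] at this
      exact ha.2 (pim_eq_zero hα (add_eq_zero.1 this.symm).1)
    · have := D_sum (fun a => pim α a) hop v hwv
      rw [map_list_sum, this, ← h3, map_list_sum]
  obtain ⟨B, hBW, hB⟩ := hex C hCW hDC
  have hsupp : ((Finsupp.lmapDomain K K (F α 0) B).support : Set (Finset (M e))) ⊆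
      Set.range (oval : OFace α 0 lam (m + 1) → Finset (M e)) := by
    intro S hS
    obtain ⟨w, hw, rfl⟩ := Finset.mem_image.1 (Finsupp.mapDomain_support (Finset.mem_coe.1 hS))
    obtain ⟨h1, h2, h3⟩ := hBW w hw
    have h1' : ∀ a ∈ w, a ≠ 0 := fun a ha => (h1 a ha).2
    refine ⟨⟨F α 0 w, h3 ▸ F_face hα w h1', ?_⟩, rfl⟩
    rw [F_card hα w 0 h1', h2]; rfl
  set b : OC K α 0 lam (m + 1) := Finsupp.comapDomain oval (Finsupp.lmapDomain K K (F α 0) B)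
    oval_inj.injOn with hb
  have hembb : emb K α 0 lam (m + 1) b = Finsupp.lmapDomain K K (F α 0) B :=
    Finsupp.mapDomain_comapDomain _ oval_inj _ hsupp
  refine ⟨b, ?_⟩
  apply emb_inj
  refine (emb_obd α 0 lam (m + 1) b).trans ?_
  rw [hembb, ← F_lD hα _ hop B (fun w hw a ha => ((hBW w hw).1 a ha).2), hB, hFC]
  rfl

end faces
end ASGP
namespace ASGP
open ASG

section filt
variable {e n : ℕ} {K : Type} [Field K]

structure TO (lt : MX n → MX n → Prop) : Prop where
  wf : WellFounded lt
  tri : ∀ a b, lt a b ∨ a = b ∨ lt b a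
  irr : ∀ a, ¬ lt a a
  trans : ∀ a b c, lt a b → lt b c → lt a c
  add : ∀ a b c, lt a b → lt (a + c) (b + c)

structure NF (α : Fin n → M e) (lt : MX n → MX n → Prop) (nf : MX n → MX n) : Prop where
  pi : ∀ a, pim α (nf a) = pim α a
  congr : ∀ a b, pim α a = pim α b → nf a = nf b
  min : ∀ a b, pim α b = pim α a → nf a = b ∨ lt (nf a) b

lemma exists_nf (α : Fin n → M e) {lt : MX n → MX n → Prop} (h : TO lt) : ∃ nf, NF α lt nf := by
  have hne : ∀ a, {b | pim α b = pim α a}.Nonempty := fun a => ⟨a, rfl⟩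
  have hpi : ∀ a, pim α (h.wf.min _ (hne a)) = pim α a := fun a => h.wf.min_mem _ (hne a)
  have hmin : ∀ a b, pim α b = pim α a → h.wf.min _ (hne a) = b ∨ lt (h.wf.min _ (hne a)) b := by
    intro a b hb
    have := h.wf.not_lt_min _ (x := b) (show b ∈ {b | pim α b = pim α a} from hb)
    rcases h.tri (h.wf.min _ (hne a)) b with h1 | h1 | h1
    · exact Or.inr h1
    · exact Or.inl h1
    · exact absurd h1 this
  refine ⟨fun a => h.wf.min _ (hne a), hpi, ?_, hmin⟩
  intro a b hab
  rcases hmin a _ ((hpi b).trans hab.symm) with h1 | h1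
  · exact h1
  rcases hmin b _ ((hpi a).trans hab) with h2 | h2
  · exact h2.symm
  exact absurd (h.trans _ _ _ h1 h2) (h.irr _)

def JJ (nf : MX n → MX n) : Set (MX n) := {a | nf a ≠ a}

lemma JJ_lt {α : Fin n → M e} {lt : MX n → MX n → Prop} {nf : MX n → MX n} (hn : NF α lt nf)
    {a : MX n} (ha : a ∈ JJ nf) : lt (nf a) a := (hn.min a a rfl).resolve_left ha

lemma mem_JJ {α : Fin n → M e} {lt : MX n → MX n → Prop} {nf : MX n → MX n} (h : TO lt)
    (hn : NF α lt nf) {a b : MX n} (hab : pim α b = pim α a) (hlt : lt b a) : a ∈ JJ nf := by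
  intro h0
  rcases hn.min a b hab with h1 | h1
  · rw [h0] at h1; subst h1; exact h.irr _ hlt
  · rw [h0] at h1; exact h.irr _ (h.trans _ _ _ h1 hlt)

lemma JJ_up {α : Fin n → M e} {lt : MX n → MX n → Prop} {nf : MX n → MX n} (h : TO lt)
    (hn : NF α lt nf) : Up (JJ nf) := by
  intro a b ha
  exact mem_JJ h hn (b := nf a + b) (by rw [map_add, map_add, hn.pi]) (h.add _ _ _ (JJ_lt hn ha))

lemma gr_lemma {α : Fin n → M e} {lt : MX n → MX n → Prop} {nf : MX n → MX n} (h : TO lt)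
    (hn : NF α lt nf) (v : List (MX n)) :
    ∀ w ∈ (D (fun a b => nf (a + b)) (fun _ _ => (1 : K)) (fun _ _ => 1) v
      - D padd (chi K (JJ nf)) (chi K (JJ nf)) v).support, lt w.sum v.sum := by
  induction v with
  | nil => simp [D_nil]
  | cons a v ih =>
    cases v with
    | nil => simp [D_one]
    | cons b t =>
      intro w hw
      rw [D_cons, D_cons, sub_sub_sub_comm, ← map_sub] at hw
      rcases Finset.mem_union.1 (Finsupp.support_sub hw) with h1 | h1
      · by_cases hJ : a + b ∈ JJ nf
        · simp only [chi, if_pos hJ, Finsupp.single_zero, sub_zero] at h1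
          have := Finset.mem_singleton.1 (Finsupp.support_single_subset h1)
          subst this
          simp only [List.sum_cons, ← add_assoc]
          exact h.add _ _ _ (JJ_lt hn hJ)
        · have h2 : nf (a + b) = a + b := not_not.1 hJ
          simp [chi, if_neg hJ, padd, h2] at h1
      · obtain ⟨w', h2, rfl⟩ := Finset.mem_image.1 (Finsupp.mapDomain_support h1)
        have := h.add _ _ a (ih w' h2)
        rw [List.sum_cons, List.sum_cons, add_comm a, add_comm a]
        exact this

lemma gr_lemma' {α : Fin n → M e} {lt : MX n → MX n → Prop} {nf : MX n → MX n} (h : TO lt)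
    (hn : NF α lt nf) (x : List (MX n) →₀ K) :
    ∀ w ∈ (lD (fun a b => nf (a + b)) (fun _ _ => (1 : K)) (fun _ _ => 1) x
      - DL K (JJ nf) (JJ nf) x).support, ∃ v ∈ x.support, lt w.sum v.sum := by
  intro w hw
  by_contra! hcon
  rw [Finsupp.mem_support_iff] at hw
  apply hw
  rw [DL, lD, lD, Finsupp.linearCombination_apply, Finsupp.linearCombination_apply, Finsupp.sum,
    Finsupp.sum, ← Finset.sum_sub_distrib, Finsupp.finsetSum_apply]
  apply Finset.sum_eq_zero
  intro v hv
  rw [← smul_sub, Finsupp.smul_apply]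
  have : w ∉ (D (fun a b => nf (a + b)) (fun _ _ => (1 : K)) (fun _ _ => 1) v
      - D padd (chi K (JJ nf)) (chi K (JJ nf)) v).support :=
    fun h' => hcon v hv (gr_lemma h hn v w h')
  rw [Finsupp.notMem_support_iff] at this
  rw [this, smul_zero]

lemma exists_max {lt : MX n → MX n → Prop} (h : TO lt) (s : Finset (List (MX n)))
    (hs : s.Nonempty) : ∃ x ∈ s, ∀ y ∈ s, y.sum = x.sum ∨ lt y.sum x.sum := by
  induction hs using Finset.Nonempty.cons_induction with
  | singleton a => exact ⟨a, by simp, by simp⟩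
  | cons a s ha hs ih =>
    obtain ⟨x, hx, hmax⟩ := ih
    rcases h.tri a.sum x.sum with h1 | h1 | h1
    · refine ⟨x, by simp [hx], ?_⟩
      intro y hy
      rcases Finset.mem_cons.1 hy with rfl | hy
      · exact Or.inr h1
      · exact hmax y hy
    · refine ⟨x, by simp [hx], ?_⟩
      intro y hy
      rcases Finset.mem_cons.1 hy with rfl | hy
      · exact Or.inl h1
      · exact hmax y hy
    · refine ⟨a, by simp, ?_⟩
      intro y hy
      rcases Finset.mem_cons.1 hy with rfl | hy
      · exact Or.inl rfl
      · rcases hmax y hy with h2 | h2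
        · rw [h2]; exact Or.inr h1
        · exact Or.inr (h.trans _ _ _ h2 h1)

def VW (α : Fin n → M e) (nf : MX n → MX n) (lam : M e) (r : ℕ) (w : List (MX n)) : Prop :=
  (∀ a ∈ w, nf a = a ∧ a ≠ 0) ∧ w.length = r ∧ pim α w.sum = lam

lemma filt_lemma {α : Fin n → M e} (hα : ∀ i, α i ≠ 0) {lt : MX n → MX n → Prop}
    {nf : MX n → MX n} (h : TO lt) (hn : NF α lt nf) {d : ℕ} (hd1 : 1 ≤ d)
    (hgen : ∀ b ∈ JJ nf, ∃ g ∈ JJ nf, g ≤ b ∧ g.degree ≤ d + 1) (lam : M e) (m : ℕ)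
    (hdeg : ∀ β, pim α β = lam → 1 + m * d < β.degree) (β : MX n) :
    ∀ C : List (MX n) →₀ K, (∀ w ∈ C.support, VW α nf lam (m + 1) w) →
      (∀ w ∈ C.support, w.sum = β ∨ lt w.sum β) →
      lD (fun a b => nf (a + b)) (fun _ _ => 1) (fun _ _ => 1) C = 0 →
      ∃ B : List (MX n) →₀ K, (∀ w ∈ B.support, VW α nf lam (m + 2) w) ∧
      lD (fun a b => nf (a + b)) (fun _ _ => 1) (fun _ _ => 1) B = C := by
  have hidem : ∀ a, nf (nf a) = nf a := fun a => hn.congr _ _ (hn.pi a)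
  have hop : ∀ a b, pim α (nf (a + b)) = pim α a + pim α b := fun a b => by rw [hn.pi, map_add]
  have h0J : (0 : MX n) ∉ JJ nf := by
    intro h0
    apply h0
    apply pim_eq_zero hα
    rw [hn.pi, map_zero]
  have hDD : ∀ x : List (MX n) →₀ K, lD (fun a b => nf (a + b)) (fun _ _ => 1) (fun _ _ => 1)
      (lD (fun a b => nf (a + b)) (fun _ _ => 1) (fun _ _ => 1) x) = 0 := by
    intro x
    apply lD_lD
    · intro a b c
      apply hn.congr
      simp only [map_add, hn.pi, add_assoc]
    · simp
    · simp
  have hVWD : ∀ x : List (MX n) →₀ K, (∀ w ∈ x.support, VW α nf lam (m + 2) w) →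
      ∀ w ∈ (lD (fun a b => nf (a + b)) (fun _ _ => 1) (fun _ _ => 1) x).support,
        VW α nf lam (m + 1) w := by
    intro x hx w hw
    obtain ⟨v, hv, hwv⟩ := mem_lD_support hw
    obtain ⟨h1, h2, h3⟩ := hx v hv
    refine ⟨?_, ?_, ?_⟩
    · refine D_all (fun a => nf a = a ∧ a ≠ 0) ?_ v h1 hwv
      intro a b ha hb _
      refine ⟨hidem _, ?_⟩
      intro h0
      have := hop a b
      rw [h0, map_zero] at this
      exact ha.2 (pim_eq_zero hα (add_eq_zero.1 this.symm).1)
    · have := (D_length _ hwv).1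
      omega
    · have := D_sum (fun a => pim α a) hop v hwv
      rw [map_list_sum, this, ← h3, map_list_sum]
  induction β using h.wf.induction with
  | _ β ih =>
  -- chains strictly below β
  have hlow : ∀ C : List (MX n) →₀ K, (∀ w ∈ C.support, VW α nf lam (m + 1) w) →
      (∀ w ∈ C.support, lt w.sum β) →
      lD (fun a b => nf (a + b)) (fun _ _ => 1) (fun _ _ => 1) C = 0 →
      ∃ B : List (MX n) →₀ K, (∀ w ∈ B.support, VW α nf lam (m + 2) w) ∧
      lD (fun a b => nf (a + b)) (fun _ _ => 1) (fun _ _ => 1) B = C := by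
    intro C hC hCl hCz
    by_cases hne : C.support.Nonempty
    · obtain ⟨x, hx, hmax⟩ := exists_max h _ hne
      exact ih x.sum (hCl x hx) C hC hmax hCz
    · rw [Finset.not_nonempty_iff_eq_empty, Finsupp.support_eq_empty] at hne
      exact ⟨0, by simp, by simp [hne]⟩
  intro C hC hCl hCz
  by_cases hex : ∃ w ∈ C.support, w.sum = β
  · obtain ⟨w0, hw0, hw0β⟩ := hex
    have hβ : pim α β = lam := hw0β ▸ (hC w0 hw0).2.2
    set C1 := C.filter (fun w => w.sum = β) with hC1
    set C2 := C.filter (fun w => ¬ w.sum = β) with hC2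
    have hC12 : C1 + C2 = C := Finsupp.filter_pos_add_filter_neg C _
    have hs1 : ∀ w ∈ C1.support, w ∈ C.support ∧ w.sum = β := by
      intro w hw
      rw [hC1, Finsupp.support_filter, Finset.mem_filter] at hw
      exact hw
    have hs2 : ∀ w ∈ C2.support, w ∈ C.support ∧ lt w.sum β := by
      intro w hw
      rw [hC2, Finsupp.support_filter, Finset.mem_filter] at hw
      exact ⟨hw.1, (hCl w hw.1).resolve_left hw.2⟩
    have hJsum : ∀ x : List (MX n) →₀ K, ∀ w ∈ (DL K (JJ nf) (JJ nf) x).support,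
        ∃ v ∈ x.support, w.sum = v.sum := by
      intro x w hw
      obtain ⟨v, hv, hwv⟩ := mem_lD_support hw
      have := D_sum (fun x => x) (fun a b => rfl) _ hwv
      simp at this
      exact ⟨v, hv, this⟩
    have hlow2 : ∀ w ∈ (lD (fun a b => nf (a + b)) (fun _ _ => (1 : K)) (fun _ _ => 1) C2).support,
        lt w.sum β := by
      intro w hw
      have e1 : lD (fun a b => nf (a + b)) (fun _ _ => (1 : K)) (fun _ _ => 1) C2 =
        (lD (fun a b => nf (a + b)) (fun _ _ => (1 : K)) (fun _ _ => 1) C2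
          - DL K (JJ nf) (JJ nf) C2) + DL K (JJ nf) (JJ nf) C2 := by abel
      rw [e1] at hw
      rcases Finset.mem_union.1 (Finsupp.support_add hw) with hw | hw
      · obtain ⟨v, hv, hlt⟩ := gr_lemma' h hn C2 w hw
        exact h.trans _ _ _ hlt (hs2 v hv).2
      · obtain ⟨v, hv, hlt⟩ := hJsum C2 w hw
        rw [hlt]; exact (hs2 v hv).2
    have hz : DL K (JJ nf) (JJ nf) C1 = 0 := by
      rw [← Finsupp.support_eq_empty, Finset.eq_empty_iff_forall_notMem]
      intro w hw
      obtain ⟨v, hv, hwv⟩ := hJsum C1 w hw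
      have hwβ : w.sum = β := hwv.trans (hs1 v hv).2
      have e1 : DL K (JJ nf) (JJ nf) C1 =
        - (lD (fun a b => nf (a + b)) (fun _ _ => (1 : K)) (fun _ _ => 1) C1
          - DL K (JJ nf) (JJ nf) C1)
        - lD (fun a b => nf (a + b)) (fun _ _ => (1 : K)) (fun _ _ => 1) C2 := by
        rw [← hC12, map_add] at hCz
        rw [eq_neg_of_add_eq_zero_left hCz]; abel
      rw [e1] at hw
      rcases Finset.mem_union.1 (Finsupp.support_sub hw) with hw | hw
      · rw [Finsupp.support_neg] at hw
        obtain ⟨v, hv, hlt⟩ := gr_lemma' h hn C1 w hw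
        rw [(hs1 v hv).2, hwβ] at hlt
        exact h.irr _ hlt
      · have := hlow2 w hw
        rw [hwβ] at this
        exact h.irr _ this
    obtain ⟨b, hb, hbC⟩ := ex_bar (K := K) (JJ_up h hn) h0J hd1 hgen m β (hdeg β hβ) C1 (by
      intro w hw
      obtain ⟨h1, h2⟩ := hs1 w hw
      obtain ⟨g1, g2, g3⟩ := hC w h1
      exact ⟨fun a ha => ⟨not_not.2 (g1 a ha).1, (g1 a ha).2⟩, g2, h2⟩) hz
    have hbV : ∀ w ∈ b.support, VW α nf lam (m + 2) w := by
      intro w hw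
      obtain ⟨h1, h2, h3⟩ := hb w hw
      exact ⟨fun a ha => ⟨not_not.1 (h1 a ha).1, (h1 a ha).2⟩, h2, by rw [h3, hβ]⟩
    obtain ⟨B, hBV, hB⟩ := hlow
      (C - lD (fun a b => nf (a + b)) (fun _ _ => 1) (fun _ _ => 1) b) (by
        intro w hw
        rcases Finset.mem_union.1 (Finsupp.support_sub hw) with hw | hw
        · exact hC w hw
        · exact hVWD b hbV w hw) (by
        intro w hw
        have e1 : C - lD (fun a b => nf (a + b)) (fun _ _ => (1 : K)) (fun _ _ => 1) b =
          C2 - (lD (fun a b => nf (a + b)) (fun _ _ => (1 : K)) (fun _ _ => 1) b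
            - DL K (JJ nf) (JJ nf) b) := by
          rw [hbC, ← hC12]; abel
        rw [e1] at hw
        rcases Finset.mem_union.1 (Finsupp.support_sub hw) with hw | hw
        · exact (hs2 w hw).2
        · obtain ⟨v, hv, hlt⟩ := gr_lemma' h hn b w hw
          rwa [(hb v hv).2.2] at hlt) (by
        rw [map_sub, hCz, hDD, sub_zero])
    refine ⟨B + b, ?_, ?_⟩
    · intro w hw
      rcases Finset.mem_union.1 (Finsupp.support_add hw) with hw | hw
      · exact hBV w hw
      · exact hbV w hw
    · rw [map_add, hB, sub_add_cancel]
  · push Not at hex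
    exact hlow C hC (fun w hw => (hCl w hw).resolve_left (hex w hw)) hCz

lemma exists_list (α : Fin n → M e) (β : MX n) :
    ∃ l : List (Fin n), l.length = β.degree ∧ (l.map α).sum = pim α β := by
  induction β using Finsupp.induction_linear with
  | zero => exact ⟨[], by simp, by simp⟩
  | add f g hf hg =>
    obtain ⟨l, h1, h2⟩ := hf
    obtain ⟨l', h1', h2'⟩ := hg
    exact ⟨l ++ l', by simp [h1, h1'], by simp [h2, h2']⟩
  | single i k => exact ⟨List.replicate k i, by simp, by simp [pim]⟩

lemma deg_le (α : Fin n → M e) (β : MX n) : deg α (pim α β) ≤ β.degree := by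
  obtain ⟨l, h1, h2⟩ := exists_list α β
  apply Nat.sInf_le
  rw [← h1]
  refine ⟨fun t => l.get t, ?_⟩
  rw [← h2, ← List.sum_ofFn]
  congr 1
  conv_lhs => rw [← List.ofFn_get l]
  rw [List.map_ofFn]
  rfl

lemma aeval_mono (k : Type) [Field k] (α : Fin n → M e) (m : MX n) :
    MvPolynomial.aeval (R := k)
      (fun i : Fin n => (MvPolynomial.monomial (α i) 1 : MvPolynomial (Fin e) k))
      (MvPolynomial.monomial m 1) = MvPolynomial.monomial (pim α m) 1 := by
  induction m using Finsupp.induction_linear with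
  | zero => simp
  | add f g hf hg =>
    have : (MvPolynomial.monomial (f + g) 1 : MvPolynomial (Fin n) k) =
      MvPolynomial.monomial f 1 * MvPolynomial.monomial g 1 := by simp
    rw [this, map_mul, hf, hg, map_add]; simp
  | single i k =>
    rw [← MvPolynomial.X_pow_eq_monomial, map_pow, MvPolynomial.aeval_X, MvPolynomial.monomial_pow]
    simp [pim]

lemma toric_other (k : Type) [Field k] (α : Fin n → M e) (f : MvPolynomial (Fin n) k)
    (hf : f ∈ toricIdeal k α) (mo : MX n) (hmo : mo ∈ f.support) :
    ∃ m' ∈ f.support, m' ≠ mo ∧ pim α m' = pim α mo := by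
  by_contra! hcon
  have h0 : MvPolynomial.aeval (R := k)
      (fun i : Fin n => (MvPolynomial.monomial (α i) 1 : MvPolynomial (Fin e) k)) f = 0 := hf
  have h1 : MvPolynomial.aeval (R := k)
      (fun i : Fin n => (MvPolynomial.monomial (α i) 1 : MvPolynomial (Fin e) k)) f =
      ∑ m ∈ f.support, MvPolynomial.monomial (pim α m) (MvPolynomial.coeff m f) := by
    conv_lhs => rw [MvPolynomial.as_sum f]
    rw [map_sum]
    apply Finset.sum_congr rfl
    intro m _
    have : (MvPolynomial.monomial m (MvPolynomial.coeff m f) : MvPolynomial (Fin n) k) =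
      MvPolynomial.coeff m f • MvPolynomial.monomial m 1 := by simp [MvPolynomial.smul_monomial]
    rw [this, map_smul, aeval_mono, MvPolynomial.smul_monomial]; simp
  rw [h0] at h1
  have h2 := congrArg (MvPolynomial.coeff (pim α mo)) h1
  rw [MvPolynomial.coeff_zero, MvPolynomial.coeff_sum, Finset.sum_eq_single mo] at h2
  · rw [MvPolynomial.coeff_monomial, if_pos rfl] at h2
    exact (MvPolynomial.mem_support_iff.1 hmo) h2.symm
  · intro m hm hne
    rw [MvPolynomial.coeff_monomial, if_neg (hcon m hm hne)]
  · intro h; exact absurd hmo h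

lemma binom_mem (k : Type) [Field k] (α : Fin n → M e) (a b : MX n) (h : pim α a = pim α b) :
    (MvPolynomial.monomial a 1 - MvPolynomial.monomial b 1 : MvPolynomial (Fin n) k)
      ∈ toricIdeal k α := by
  show MvPolynomial.aeval (R := k)
      (fun i : Fin n => (MvPolynomial.monomial (α i) 1 : MvPolynomial (Fin e) k)) _ = 0
  rw [map_sub, aeval_mono, aeval_mono, h, sub_self]

lemma span_mono (k : Type) [Field k] (G : Set (MX n)) (b : MX n) :
    (MvPolynomial.monomial b 1 : MvPolynomial (Fin n) k) ∈
      Ideal.span ((fun mo => (MvPolynomial.monomial mo 1 : MvPolynomial (Fin n) k)) '' G) ↔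
    ∃ g ∈ G, ∃ c, b = g + c := by
  rw [MvPolynomial.mem_ideal_span_monomial_image]
  constructor
  · intro h
    obtain ⟨g, hg, hle⟩ := h b (by simp)
    exact ⟨g, hg, exists_add_of_le hle⟩
  · rintro ⟨g, hg, c, rfl⟩ xi hxi
    have : xi = g + c := by
      by_contra hne
      rw [MvPolynomial.mem_support_iff, MvPolynomial.coeff_monomial, if_neg (Ne.symm hne)] at hxi
      exact hxi rfl
    exact ⟨g, hg, this ▸ le_self_add⟩

lemma wqo (f : ℕ → MX n) : ∃ i j, i < j ∧ ∃ c, f j = f i + c := by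
  obtain ⟨i, j, hij, h⟩ := wellQuasiOrdered_le (α := MX n) f
  exact ⟨i, j, hij, exists_add_of_le h⟩

lemma TO_of_ord (ord : LinearOrder (MX n)) (hord : IsTermOrder ord) :
    TO (fun a b => ord.lt a b) := by
  have hadd : ∀ a b c, ord.lt a b → ord.lt (a + c) (b + c) := by
    intro a b c hab
    have h1 := hord.2 a b c (@le_of_lt _ ord.toPreorder _ _ hab)
    refine (@lt_or_eq_of_le _ ord.toPartialOrder _ _ h1).resolve_right ?_
    intro h
    have : a = b := add_right_cancel h
    subst this
    exact @lt_irrefl _ ord.toPreorder _ hab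
  refine ⟨?_, fun a b => @lt_trichotomy _ ord a b, fun a => @lt_irrefl _ ord.toPreorder a,
    fun a b c => @lt_trans _ ord.toPreorder a b c, hadd⟩
  rw [wellFounded_iff_isEmpty_descending_chain]
  refine ⟨?_⟩
  rintro ⟨f, hf⟩
  have hdec : ∀ i j, i < j → ord.lt (f j) (f i) := by
    intro i j hij
    induction j, hij using Nat.le_induction with
    | base => exact hf i
    | succ j _ ih => exact @lt_trans _ ord.toPreorder _ _ _ (hf j) ih
  obtain ⟨i, j, hij, c, hc⟩ := wqo f
  have h1 := hdec i j hij
  have h2 : ord.le (f i) (f j) := by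
    have := hord.2 0 c (f i) (hord.1 c)
    rwa [zero_add, add_comm, ← hc] at this
  exact @not_lt_of_ge _ ord.toPreorder _ _ h2 h1

lemma gen_of_GB {k : Type} [Field k] {ord : LinearOrder (MX n)} (hord : IsTermOrder ord)
    {α : Fin n → M e} {d : ℕ} (hGB : HasGB k ord α d) {nf : MX n → MX n}
    (hn : NF α (fun a b => ord.lt a b) nf) :
    ∀ b ∈ JJ nf, ∃ g ∈ JJ nf, (∃ c, b = g + c) ∧ g.degree ≤ d := by
  intro b hb
  obtain ⟨G, hG, hspan⟩ := hGB
  have hTO := TO_of_ord ord hord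
  set LM : Set (MX n) := {mo | ∃ f ∈ toricIdeal k α, f ≠ 0 ∧
    (mo ∈ f.support ∧ ∀ m' ∈ f.support, ord.le m' mo)} with hLM
  have hin : initialIdeal k ord α =
      Ideal.span ((fun mo => (MvPolynomial.monomial mo 1 : MvPolynomial (Fin n) k)) '' LM) := by
    rw [initialIdeal]
    congr 1
    ext p
    constructor
    · rintro ⟨f, h1, h2, mo, h3, rfl⟩
      exact ⟨mo, ⟨f, h1, h2, h3⟩, rfl⟩
    · rintro ⟨mo, ⟨f, h1, h2, h3⟩, rfl⟩
      exact ⟨f, h1, h2, mo, h3, rfl⟩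
  have hbLM : b ∈ LM := by
    have hne : nf b ≠ b := hb
    have hcb : MvPolynomial.coeff b
        (MvPolynomial.monomial b 1 - MvPolynomial.monomial (nf b) 1 : MvPolynomial (Fin n) k) = 1 := by
      rw [MvPolynomial.coeff_sub, MvPolynomial.coeff_monomial, MvPolynomial.coeff_monomial,
        if_pos rfl, if_neg hne, sub_zero]
    refine ⟨MvPolynomial.monomial b 1 - MvPolynomial.monomial (nf b) 1,
      binom_mem k α b (nf b) (hn.pi b).symm, ?_, ?_, ?_⟩
    · intro h0
      rw [h0, MvPolynomial.coeff_zero] at hcb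
      exact zero_ne_one hcb
    · rw [MvPolynomial.mem_support_iff, hcb]; exact one_ne_zero
    · intro m' hm'
      rw [MvPolynomial.mem_support_iff, MvPolynomial.coeff_sub, MvPolynomial.coeff_monomial,
        MvPolynomial.coeff_monomial] at hm'
      by_cases h1 : b = m'
      · rw [h1]; exact @le_refl _ ord.toPreorder _
      · by_cases h2 : nf b = m'
        · rw [← h2]; exact @le_of_lt _ ord.toPreorder _ _ (JJ_lt hn hb)
        · rw [if_neg h1, if_neg h2, sub_zero] at hm'
          exact absurd rfl hm'
  have h1 : (MvPolynomial.monomial b 1 : MvPolynomial (Fin n) k) ∈ initialIdeal k ord α := by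
    rw [hin, span_mono]
    exact ⟨b, hbLM, 0, by simp⟩
  rw [← hspan, span_mono] at h1
  obtain ⟨g, hg, c, hbc⟩ := h1
  have h2 : (MvPolynomial.monomial g 1 : MvPolynomial (Fin n) k) ∈ initialIdeal k ord α := by
    rw [← hspan, span_mono]
    exact ⟨g, hg, 0, by simp⟩
  rw [hin, span_mono] at h2
  obtain ⟨mo, ⟨f, hf, _, hmo, hmax⟩, c', hgc⟩ := h2
  obtain ⟨m', hm', hne, hpi⟩ := toric_other k α f hf mo hmo
  have hlt : ord.lt m' mo :=
    (@lt_or_eq_of_le _ ord.toPartialOrder _ _ (hmax m' hm')).resolve_right hne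
  have hmoJ : mo ∈ JJ nf := mem_JJ hTO hn hpi hlt
  refine ⟨g, hgc ▸ JJ_up hTO hn mo c' hmoJ, ⟨c, hbc⟩, ?_⟩
  have := hG g hg
  rwa [Finsupp.degree_eq_sum, ← Finsupp.sum_fintype g (fun _ c => c) (fun _ => rfl)]

theorem main_thm
    (α : Fin n → M e) (hα : ∀ i, α i ≠ 0)
    (lt : MX n → MX n → Prop) (h : TO lt) (nf : MX n → MX n) (hn : NF α lt nf)
    (d : ℕ) (hd : 1 ≤ d)
    (hgen : ∀ b ∈ JJ nf, ∃ g ∈ JJ nf, (∃ c, b = g + c) ∧ g.degree ≤ d + 1)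
    (lam : M e) (hlam : lam ∈ sg α) (m : ℕ) (hm : 1 + m * d < deg α lam)
    (c : OC K α 0 lam m) (hc : obd K α 0 lam m c = 0) :
    ∃ b : OC K α 0 lam (m + 1), obd K α 0 lam (m + 1) b = c := by
  have hgen' : ∀ b ∈ JJ nf, ∃ g ∈ JJ nf, g ≤ b ∧ g.degree ≤ d + 1 := by
    intro b hb
    obtain ⟨g, h1, ⟨c, rfl⟩, h3⟩ := hgen b hb
    exact ⟨g, h1, le_self_add, h3⟩
  have hdeg : ∀ β, pim α β = lam → 1 + m * d < β.degree := by
    rintro β rfl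
    exact lt_of_lt_of_le hm (deg_le α β)
  have hlt : sgLT α 0 lam := by
    refine ⟨⟨lam, hlam, zero_add _⟩, ?_⟩
    rintro rfl
    have := hdeg 0 (map_zero _)
    simp at this
  refine transfer hα nf hn.pi hn.congr lam hlt m ?_ c hc
  intro C hC hCz
  by_cases hne : C.support.Nonempty
  · obtain ⟨x, hx, hmax⟩ := exists_max h _ hne
    exact filt_lemma hα h hn hd hgen' lam m hdeg x.sum C hC hmax hCz
  · rw [Finset.not_nonempty_iff_eq_empty, Finsupp.support_eq_empty] at hne
    exact ⟨0, by simp, by simp [hne]⟩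

end filt
end ASGP

open ASG in
/-- If for some field `k` and some monomial term order `⪯`
the toric ideal `I_Λ ⊆ k[z_1, …, z_n]` has a Gröbner basis of degree `d ≥ 2`,
then for every field `K`, every `λ ∈ Λ` and every integer
`i < -1 + (deg λ - 1)/(d - 1)`, the reduced simplicial homology
`H̃_i(Δ(0,λ); K)` vanishes. -/
theorem groebner_degree_bound_reduced_homology_vanishing
    (e n : ℕ) (α : Fin n → M e) (hα : ∀ i, α i ≠ 0)
    (k : Type) [Field k] (ord : LinearOrder (Fin n →₀ ℕ)) (hord : IsTermOrder ord)
    (d : ℕ) (hd : 2 ≤ d) (hGB : HasGB k ord α d)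
    (K : Type) [Field K] (lam : M e) (hlam : lam ∈ sg α)
    (i : ℤ) (hi : (i : ℚ) < -1 + ((deg α lam : ℚ) - 1) / ((d : ℚ) - 1)) :
    HredVanishes K α 0 lam i := by
  intro m hm c hc
  obtain ⟨nf, hn⟩ := ASGP.exists_nf α (ASGP.TO_of_ord ord hord)
  obtain ⟨d', rfl⟩ : ∃ d', d = d' + 1 := ⟨d - 1, by omega⟩
  have hd' : 1 ≤ d' := by omega
  refine ASGP.main_thm α hα _ (ASGP.TO_of_ord ord hord) nf hn d' hd'
    (ASGP.gen_of_GB hord hGB hn) lam hlam m ?_ c hc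
  have hi' : (i : ℚ) = (m : ℚ) - 1 := by
    have : i = (m : ℤ) - 1 := by omega
    rw [this]; push_cast; ring
  have hpos : (0 : ℚ) < d' := by exact_mod_cast hd'
  rw [hi'] at hi
  push_cast at hi
  rw [add_sub_cancel_right] at hi
  have h1 : (m : ℚ) < ((deg α lam : ℚ) - 1) / d' := by linarith
  rw [lt_div_iff₀ hpos] at h1
  have h2 : (1 : ℚ) + m * d' < deg α lam := by linarith
  exact_mod_cast h2
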